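/- Suppose H : [0,T] × C × ℝⁿ → ℝ satisfies conditions (A.1), (A.2), (A.4), (A.5), σ : C → ℝ satisfies (A.6), and H additionally satisfies the strengthened condition (A.3′): for every bounded set D ⊂ C there exists a nonnegative λ_H(·) = λ_H(·;D) ∈ L¹([0,T],ℝ) such that for all x₁(·), x₂(·) ∈ D and s ∈ ℝⁿ there is a set E ⊂ [0,T] with μ(E) = T on which |H(t,x₁(·),s) − H(t,x₂(·),s)| ≤ λ_H(t)(1+‖s‖)‖x₁(·∧t) − x₂(·∧t)‖_∞. Then there exists a set E ⊂ [0,T) with μ(E) = T such that any minimax solution φ of the Cauchy problem satisfies ∂ₜφ(t,x(·)) + H(t,x(·),∇φ(t,x(·))) = 0 at every point (t,x(·)) ∈ E × C at which φ is ci-differentiable. -/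

import Mathlib

open MeasureTheory Set Filter Topology

noncomputable section

attribute [local instance] Classical.propDecidable

/-- Euclidean space `ℝⁿ`. -/
abbrev Euc (n : ℕ) : Type := EuclideanSpace ℝ (Fin n)

/-- The path space `C([-h,T], ℝⁿ)` with the sup norm. -/
abbrev PathSp (n : ℕ) (h T : ℝ) : Type := ContinuousMap (Set.Icc (-h) T) (Euc n)

/-- The time map `τ ↦ τ ∧ t` on `[-h,T]` (for `t ∈ [0,T]`, `h ≥ 0`, this is `min τ t`). -/
def stopTime (h T t : ℝ) (τ : Set.Icc (-h) T) : Set.Icc (-h) T :=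
  ⟨max (-h) (min τ.1 t), le_max_left _ _,
    max_le (le_trans τ.2.1 τ.2.2) (le_trans (min_le_left _ _) τ.2.2)⟩

lemma continuous_stopTime (h T t : ℝ) : Continuous (stopTime h T t) :=
  Continuous.subtype_mk
    (continuous_const.max (continuous_subtype_val.min continuous_const)) _

/-- The stopped path `x(· ∧ t)`. -/
def stopPath {n : ℕ} {h T : ℝ} (t : ℝ) (x : PathSp n h T) : PathSp n h T :=
  x.comp ⟨stopTime h T t, continuous_stopTime h T t⟩

/-- Evaluation of a path at a real time (times outside `[-h,T]` are projected). -/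
def evalP {n : ℕ} {h T : ℝ} (x : PathSp n h T) (τ : ℝ) : Euc n :=
  if hc : -h ≤ T then x (Set.projIcc (-h) T hc τ) else 0

/-- The `L¹([0,T])` distance between two functions. -/
def L1dist (T : ℝ) (c₁ c₂ : ℝ → ℝ) : ℝ := ∫ τ in Set.Icc (0:ℝ) T, |c₁ τ - c₂ τ|

/-- A nonnegative function in `L¹([0,T],ℝ)`. -/
def IntegNonneg (T : ℝ) (c : ℝ → ℝ) : Prop :=
  IntegrableOn c (Set.Icc 0 T) volume ∧ ∀ τ ∈ Set.Icc (0:ℝ) T, 0 ≤ c τ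

/-- `AC(t,x(·))`, presented with an explicit derivative witness: pairs `(y, y')`
such that `y(·∧t) = x(·∧t)`, `y'` is integrable on `[t,T]`, and `y` is the
indefinite integral of `y'` on `[t,T]` (i.e. `y|_{[t,T]}` is absolutely continuous
with a.e. derivative `y'`). -/
def ACPair {n : ℕ} {h T : ℝ} (t : ℝ) (x : PathSp n h T) :
    Set (PathSp n h T × (ℝ → Euc n)) :=
  {p | stopPath t p.1 = stopPath t x ∧ IntervalIntegrable p.2 volume t T ∧
       ∀ τ ∈ Set.Icc t T, evalP p.1 τ = evalP p.1 t + ∫ ξ in t..τ, p.2 ξ}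

/-- The set `AC(t,x(·))`. -/
def ACSet {n : ℕ} {h T : ℝ} (t : ℝ) (x : PathSp n h T) : Set (PathSp n h T) :=
  {y | ∃ y', (y, y') ∈ ACPair t x}

/-- Pairs `(y, y')` with `y ∈ Y(t,x(·);c(·))` and derivative witness `y'`. -/
def YPair {n : ℕ} {h T : ℝ} (t : ℝ) (x : PathSp n h T) (c : ℝ → ℝ) :
    Set (PathSp n h T × (ℝ → Euc n)) :=
  {p | p ∈ ACPair t x ∧
       ∀ᵐ τ ∂(volume.restrict (Set.Icc t T)), ‖p.2 τ‖ ≤ c τ * (1 + ‖stopPath τ p.1‖)}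

/-- The set `Y(t,x(·);c(·))`. -/
def YSet {n : ℕ} {h T : ℝ} (t : ℝ) (x : PathSp n h T) (c : ℝ → ℝ) :
    Set (PathSp n h T) :=
  {y | ∃ y', (y, y') ∈ YPair t x c}

/-- Condition (A.1): measurability in `t` on `[0,T]`. -/
def CondA1 {n : ℕ} {h T : ℝ} (H : ℝ → PathSp n h T → Euc n → ℝ) : Prop :=
  ∀ (x : PathSp n h T) (s : Euc n),
    Measurable ((Set.Icc (0:ℝ) T).restrict (fun t => H t x s))

/-- Condition (A.2): continuity in `(x,s)` for a.e. `t`. -/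
def CondA2 {n : ℕ} {h T : ℝ} (H : ℝ → PathSp n h T → Euc n → ℝ) : Prop :=
  ∃ E : Set ℝ, E ⊆ Set.Icc 0 T ∧ volume E = ENNReal.ofReal T ∧
    ∀ t ∈ E, Continuous (fun p : PathSp n h T × Euc n => H t p.1 p.2)

/-- Condition (A.3) for a given compact set `D` and function `λ_H(·;D)`. -/
def CondA3For {n : ℕ} {h T : ℝ} (H : ℝ → PathSp n h T → Euc n → ℝ)
    (D : Set (PathSp n h T)) (lam : ℝ → ℝ) : Prop :=
  IntegNonneg T lam ∧
  ∀ x₁ ∈ D, ∀ x₂ ∈ D, ∀ s : Euc n,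
    ∃ E : Set ℝ, E ⊆ Set.Icc 0 T ∧ volume E = ENNReal.ofReal T ∧
      ∀ t ∈ E, |H t x₁ s - H t x₂ s| ≤
        lam t * (1 + ‖s‖) * ‖stopPath t x₁ - stopPath t x₂‖

/-- Condition (A.3). -/
def CondA3 {n : ℕ} {h T : ℝ} (H : ℝ → PathSp n h T → Euc n → ℝ) : Prop :=
  ∀ D : Set (PathSp n h T), IsCompact D → ∃ lam : ℝ → ℝ, CondA3For H D lam

/-- Condition (A.4), with the function `c_H(·)` made explicit. -/
def CondA4 {n : ℕ} {h T : ℝ} (H : ℝ → PathSp n h T → Euc n → ℝ) (cH : ℝ → ℝ) : Prop :=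
  IntegNonneg T cH ∧
  ∃ E : Set ℝ, E ⊆ Set.Icc 0 T ∧ volume E = ENNReal.ofReal T ∧
    ∀ t ∈ E, ∀ (x : PathSp n h T) (s₁ s₂ : Euc n),
      |H t x s₁ - H t x s₂| ≤ cH t * (1 + ‖stopPath t x‖) * ‖s₁ - s₂‖

/-- Condition (A.5) for a given compact set `D` and function `m_H(·;D)`. -/
def CondA5For {n : ℕ} {h T : ℝ} (H : ℝ → PathSp n h T → Euc n → ℝ)
    (D : Set (PathSp n h T)) (m : ℝ → ℝ) : Prop :=
  IntegNonneg T m ∧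
  ∀ x ∈ D, ∃ E : Set ℝ, E ⊆ Set.Icc 0 T ∧ volume E = ENNReal.ofReal T ∧
    ∀ t ∈ E, |H t x (0 : Euc n)| ≤ m t

/-- Condition (A.5). -/
def CondA5 {n : ℕ} {h T : ℝ} (H : ℝ → PathSp n h T → Euc n → ℝ) : Prop :=
  ∀ D : Set (PathSp n h T), IsCompact D → ∃ m : ℝ → ℝ, CondA5For H D m

/-- Conditions (A.1)–(A.5), with the function `c_H(·)` from (A.4) made explicit. -/
def CondA {n : ℕ} {h T : ℝ} (H : ℝ → PathSp n h T → Euc n → ℝ) (cH : ℝ → ℝ) : Prop :=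
  CondA1 H ∧ CondA2 H ∧ CondA3 H ∧ CondA4 H cH ∧ CondA5 H

/-- A functional `φ` on `[0,T] × C` is non-anticipative. -/
def NonAnticipative {n : ℕ} {h T : ℝ} (φ : ℝ → PathSp n h T → ℝ) : Prop :=
  ∀ t ∈ Set.Icc (0:ℝ) T, ∀ x : PathSp n h T, φ t x = φ t (stopPath t x)

/-- Property (U) from the definition of an upper solution. -/
def PropU {n : ℕ} {h T : ℝ} (H : ℝ → PathSp n h T → Euc n → ℝ) (cH : ℝ → ℝ)
    (φ : ℝ → PathSp n h T → ℝ) : Prop :=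
  ∀ t ∈ Set.Ico (0:ℝ) T, ∀ x : PathSp n h T, ∀ s : Euc n, ∀ τ ∈ Set.Ioc t T,
    ∃ p ∈ YPair t x cH,
      φ τ p.1 - ∫ ξ in t..τ, (@inner ℝ _ _ s (p.2 ξ) - H ξ p.1 s) ≤ φ t x

/-- Property (L) from the definition of a lower solution. -/
def PropL {n : ℕ} {h T : ℝ} (H : ℝ → PathSp n h T → Euc n → ℝ) (cH : ℝ → ℝ)
    (φ : ℝ → PathSp n h T → ℝ) : Prop :=
  ∀ t ∈ Set.Ico (0:ℝ) T, ∀ x : PathSp n h T, ∀ s : Euc n, ∀ τ ∈ Set.Ioc t T,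
    ∃ p ∈ YPair t x cH,
      φ t x ≤ φ τ p.1 - ∫ ξ in t..τ, (@inner ℝ _ _ s (p.2 ξ) - H ξ p.1 s)

/-- Upper solution of the Cauchy problem for `H` (with `c_H` from (A.4)) and `σ`. -/
def UpperSol {n : ℕ} {h T : ℝ} (H : ℝ → PathSp n h T → Euc n → ℝ) (cH : ℝ → ℝ)
    (σ : PathSp n h T → ℝ) (φ : ℝ → PathSp n h T → ℝ) : Prop :=
  NonAnticipative φ ∧
  LowerSemicontinuousOn (fun p : ℝ × PathSp n h T => φ p.1 p.2)
    (Set.Icc 0 T ×ˢ (Set.univ : Set (PathSp n h T))) ∧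
  (∀ x : PathSp n h T, σ x ≤ φ T x) ∧
  PropU H cH φ

/-- Lower solution of the Cauchy problem for `H` (with `c_H` from (A.4)) and `σ`. -/
def LowerSol {n : ℕ} {h T : ℝ} (H : ℝ → PathSp n h T → Euc n → ℝ) (cH : ℝ → ℝ)
    (σ : PathSp n h T → ℝ) (φ : ℝ → PathSp n h T → ℝ) : Prop :=
  NonAnticipative φ ∧
  UpperSemicontinuousOn (fun p : ℝ × PathSp n h T => φ p.1 p.2)
    (Set.Icc 0 T ×ˢ (Set.univ : Set (PathSp n h T))) ∧
  (∀ x : PathSp n h T, φ T x ≤ σ x) ∧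
  PropL H cH φ

/-- Minimax solution of the Cauchy problem. -/
def MinimaxSol {n : ℕ} {h T : ℝ} (H : ℝ → PathSp n h T → Euc n → ℝ) (cH : ℝ → ℝ)
    (σ : PathSp n h T → ℝ) (φ : ℝ → PathSp n h T → ℝ) : Prop :=
  UpperSol H cH σ φ ∧ LowerSol H cH σ φ

/-- `φ` is ci-differentiable at `(t,x(·))` with ci-derivatives `a = ∂ₜφ(t,x(·))`
and `g = ∇φ(t,x(·))`. -/
def HasCiDeriv {n : ℕ} {h T : ℝ} (φ : ℝ → PathSp n h T → ℝ)
    (t : ℝ) (x : PathSp n h T) (a : ℝ) (g : Euc n) : Prop :=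
  ∀ p ∈ ACPair t x, ∃ o : ℝ → ℝ,
    (∀ τ ∈ Set.Ioc t T,
      φ τ p.1 - φ t x =
        a * (τ - t) + @inner ℝ _ _ g (evalP p.1 τ - evalP x t) + o (τ - t)) ∧
    Tendsto (fun τ => o (τ - t) / (τ - t + ∫ ξ in t..τ, ‖p.2 ξ‖))
      (nhdsWithin t (Set.Ioi t)) (nhds 0)

/-- `φ ∈ Φ`, with the ci-derivatives `Dt = ∂ₜφ`, `Dx = ∇φ` and the full-measure
set `Eφ` of ci-differentiability made explicit. -/
structure IsInPhi {n : ℕ} {h T : ℝ} (φ : ℝ → PathSp n h T → ℝ)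
    (Dt : ℝ → PathSp n h T → ℝ) (Dx : ℝ → PathSp n h T → Euc n)
    (Eφ : Set ℝ) : Prop where
  cont : ContinuousOn (fun p : ℝ × PathSp n h T => φ p.1 p.2)
    (Set.Icc 0 T ×ˢ (Set.univ : Set (PathSp n h T)))
  absCont : ∀ t ∈ Set.Ico (0:ℝ) T, ∀ x : PathSp n h T, ∀ p ∈ ACPair t x,
    ∀ θ ∈ Set.Ioo t T, ∃ g : ℝ → ℝ, IntervalIntegrable g volume t θ ∧
      ∀ τ ∈ Set.Icc t θ, φ τ p.1 = φ t p.1 + ∫ ξ in t..τ, g ξ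
  Esub : Eφ ⊆ Set.Ico 0 T
  Efull : volume Eφ = ENNReal.ofReal T
  ciDiff : ∀ t ∈ Eφ, ∀ x : PathSp n h T, HasCiDeriv φ t x (Dt t x) (Dx t x)
  measD : ∀ x : PathSp n h T, Measurable (Eφ.restrict (fun t => (Dt t x, Dx t x)))
  contD : ∀ t ∈ Eφ, Continuous (fun x : PathSp n h T => (Dt t x, Dx t x))
  bddD : ∀ D : Set (PathSp n h T), IsCompact D → ∀ θ ∈ Set.Ico (0:ℝ) T,
    ∃ m : ℝ → ℝ, (IntegrableOn m (Set.Icc 0 θ) volume ∧ ∀ τ ∈ Set.Icc (0:ℝ) θ, 0 ≤ m τ) ∧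
      ∃ ℓ : ℝ, 0 < ℓ ∧ ∀ t ∈ Eφ ∩ Set.Icc 0 θ, ∀ x ∈ D, |Dt t x| ≤ m t ∧ ‖Dx t x‖ ≤ ℓ

/-- Semiclassical solution of the Cauchy problem (with derivative data). -/
def SemiclassicalSol {n : ℕ} {h T : ℝ} (H : ℝ → PathSp n h T → Euc n → ℝ)
    (σ : PathSp n h T → ℝ) (φ : ℝ → PathSp n h T → ℝ)
    (Dt : ℝ → PathSp n h T → ℝ) (Dx : ℝ → PathSp n h T → Euc n) (Eφ : Set ℝ) : Prop :=
  IsInPhi φ Dt Dx Eφ ∧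
  (∀ t ∈ Eφ, ∀ x : PathSp n h T, Dt t x + H t x (Dx t x) = 0) ∧
  ∀ x : PathSp n h T, φ T x = σ x

/-- The Steklov transform of `H` with respect to the first (time) variable,
with `H` extended by `0` outside `[0,T]`. -/
def steklov {n : ℕ} {h T : ℝ} (H : ℝ → PathSp n h T → Euc n → ℝ) (k : ℕ)
    (t : ℝ) (x : PathSp n h T) (s : Euc n) : ℝ :=
  ((k : ℝ) / 2) * ∫ τ in (t - (k : ℝ)⁻¹)..(t + (k : ℝ)⁻¹),
    (if τ ∈ Set.Icc (0:ℝ) T then H τ (stopPath t x) s else 0)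

/-! ### Differential game definitions -/

/-- Admissible controls with values in `P`. -/
def Ctrl {m : ℕ} (P : Set (Euc m)) : Set (ℝ → Euc m) :=
  {u | Measurable u ∧ ∀ τ, u τ ∈ P}

/-- Non-anticipative strategies mapping `Q`-valued controls to `P`-valued controls
on the interval `[t,T]`. -/
def NAStrat {mP mQ : ℕ} (P : Set (Euc mP)) (Q : Set (Euc mQ)) (t T : ℝ) :
    Set ((ℝ → Euc mQ) → ℝ → Euc mP) :=
  {α | (∀ v ∈ Ctrl Q, α v ∈ Ctrl P) ∧
    ∀ τ ∈ Set.Icc t T, ∀ v ∈ Ctrl Q, ∀ v' ∈ Ctrl Q,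
      (∀ᵐ ξ ∂(volume.restrict (Set.Icc t τ)), v ξ = v' ξ) →
      (∀ᵐ ξ ∂(volume.restrict (Set.Icc t τ)), α v ξ = α v' ξ)}

/-- `(y, y')` is (the derivative-witnessed) motion of the time-delay system
generated by `f` from `(t,x(·))` under controls `u(·)`, `v(·)`. -/
def IsMotion {n : ℕ} {h T : ℝ} {mP mQ : ℕ}
    (f : ℝ → PathSp n h T → Euc mP → Euc mQ → Euc n)
    (t : ℝ) (x : PathSp n h T) (u : ℝ → Euc mP) (v : ℝ → Euc mQ)
    (p : PathSp n h T × (ℝ → Euc n)) : Prop :=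
  p ∈ ACPair t x ∧
  ∀ᵐ τ ∂(volume.restrict (Set.Icc t T)), p.2 τ = f τ p.1 (u τ) (v τ)

/-- The set of values of the cost functional along motions (a singleton when
the motion exists and is unique). -/
def costVals {n : ℕ} {h T : ℝ} {mP mQ : ℕ}
    (f : ℝ → PathSp n h T → Euc mP → Euc mQ → Euc n)
    (χ : ℝ → PathSp n h T → Euc mP → Euc mQ → ℝ) (σ : PathSp n h T → ℝ)
    (t : ℝ) (x : PathSp n h T) (u : ℝ → Euc mP) (v : ℝ → Euc mQ) : Set ℝ :=
  {r | ∃ p : PathSp n h T × (ℝ → Euc n), IsMotion f t x u v p ∧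
        r = σ p.1 - ∫ τ in t..T, χ τ p.1 (u τ) (v τ)}

/-- The lower value `ρ⁻(t,x(·))` of the differential game. -/
def lowerValue {n : ℕ} {h T : ℝ} {mP mQ : ℕ} (P : Set (Euc mP)) (Q : Set (Euc mQ))
    (f : ℝ → PathSp n h T → Euc mP → Euc mQ → Euc n)
    (χ : ℝ → PathSp n h T → Euc mP → Euc mQ → ℝ) (σ : PathSp n h T → ℝ)
    (t : ℝ) (x : PathSp n h T) : ℝ :=
  sInf ((fun α => sSup (⋃ v ∈ Ctrl Q, costVals f χ σ t x (α v) v)) '' NAStrat P Q t T)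

/-- The upper value `ρ⁺(t,x(·))` of the differential game. -/
def upperValue {n : ℕ} {h T : ℝ} {mP mQ : ℕ} (P : Set (Euc mP)) (Q : Set (Euc mQ))
    (f : ℝ → PathSp n h T → Euc mP → Euc mQ → Euc n)
    (χ : ℝ → PathSp n h T → Euc mP → Euc mQ → ℝ) (σ : PathSp n h T → ℝ)
    (t : ℝ) (x : PathSp n h T) : ℝ :=
  sSup ((fun β => sInf (⋃ u ∈ Ctrl P, costVals f χ σ t x u (β u))) '' NAStrat Q P t T)

/-- The lower Hamiltonian `H⁻` (defined via the full-measure set `EC` from (C.2)). -/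
def Hlow {n : ℕ} {h T : ℝ} {mP mQ : ℕ} (P : Set (Euc mP)) (Q : Set (Euc mQ))
    (f : ℝ → PathSp n h T → Euc mP → Euc mQ → Euc n)
    (χ : ℝ → PathSp n h T → Euc mP → Euc mQ → ℝ) (EC : Set ℝ)
    (τ : ℝ) (y : PathSp n h T) (s : Euc n) : ℝ :=
  if τ ∈ EC then
    sSup ((fun v => sInf ((fun u => @inner ℝ _ _ s (f τ y u v) - χ τ y u v) '' P)) '' Q)
  else 0

/-- The upper Hamiltonian `H⁺` (defined via the full-measure set `EC` from (C.2)). -/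
def Hup {n : ℕ} {h T : ℝ} {mP mQ : ℕ} (P : Set (Euc mP)) (Q : Set (Euc mQ))
    (f : ℝ → PathSp n h T → Euc mP → Euc mQ → Euc n)
    (χ : ℝ → PathSp n h T → Euc mP → Euc mQ → ℝ) (EC : Set ℝ)
    (τ : ℝ) (y : PathSp n h T) (s : Euc n) : ℝ :=
  if τ ∈ EC then
    sInf ((fun u => sSup ((fun v => @inner ℝ _ _ s (f τ y u v) - χ τ y u v) '' Q)) '' P)
  else 0

/-- Assumption (C) on the data `(f, χ, σ)` of the differential game, with the
full-measure set `EC` from (C.2) and the function `c_f(·)` from (C.4) explicit. -/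
structure AssumpC {n : ℕ} {h T : ℝ} {mP mQ : ℕ} (P : Set (Euc mP)) (Q : Set (Euc mQ))
    (f : ℝ → PathSp n h T → Euc mP → Euc mQ → Euc n)
    (χ : ℝ → PathSp n h T → Euc mP → Euc mQ → ℝ)
    (σ : PathSp n h T → ℝ) (EC : Set ℝ) (cf : ℝ → ℝ) : Prop where
  meas : ∀ (y : PathSp n h T) (u : Euc mP) (v : Euc mQ),
    Measurable ((Set.Icc (0:ℝ) T).restrict (fun τ => (f τ y u v, χ τ y u v)))
  ECsub : EC ⊆ Set.Icc 0 T
  ECfull : volume EC = ENNReal.ofReal T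
  contOn : ∀ τ ∈ EC, ContinuousOn
    (fun p : PathSp n h T × Euc mP × Euc mQ => (f τ p.1 p.2.1 p.2.2, χ τ p.1 p.2.1 p.2.2))
    ((Set.univ : Set (PathSp n h T)) ×ˢ P ×ˢ Q)
  lip : ∀ D : Set (PathSp n h T), IsCompact D → ∃ lam : ℝ → ℝ, IntegNonneg T lam ∧
    ∃ E : Set ℝ, E ⊆ Set.Icc 0 T ∧ volume E = ENNReal.ofReal T ∧
      ∀ τ ∈ E, ∀ y₁ ∈ D, ∀ y₂ ∈ D, ∀ u ∈ P, ∀ v ∈ Q,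
        ‖f τ y₁ u v - f τ y₂ u v‖ + |χ τ y₁ u v - χ τ y₂ u v| ≤
          lam τ * ‖stopPath τ y₁ - stopPath τ y₂‖
  growth : IntegNonneg T cf ∧
    ∃ E : Set ℝ, E ⊆ Set.Icc 0 T ∧ volume E = ENNReal.ofReal T ∧
      ∀ τ ∈ E, ∀ y : PathSp n h T, ∀ u ∈ P, ∀ v ∈ Q,
        ‖f τ y u v‖ ≤ cf τ * (1 + ‖stopPath τ y‖)
  bdd : ∀ D : Set (PathSp n h T), IsCompact D → ∃ m : ℝ → ℝ, IntegNonneg T m ∧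
    ∃ E : Set ℝ, E ⊆ Set.Icc 0 T ∧ volume E = ENNReal.ofReal T ∧
      ∀ τ ∈ E, ∀ y ∈ D, ∀ u ∈ P, ∀ v ∈ Q, |χ τ y u v| ≤ m τ
  sigC : Continuous σ



section Helpers
variable {n : ℕ} {h T : ℝ}

lemma hT_hh (hT : 0 < T) (hh : 0 ≤ h) : -h ≤ T := by linarith

lemma evalP_eq (hc : -h ≤ T) (x : PathSp n h T) (τ : ℝ) :
    evalP x τ = x (Set.projIcc (-h) T hc τ) := by
  simp [evalP, hc]

lemma evalP_val (x : PathSp n h T) (s : Set.Icc (-h) T) : evalP x s.1 = x s := by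
  rw [evalP_eq (s.2.1.trans s.2.2), Set.projIcc_val]

lemma continuous_evalP (x : PathSp n h T) : Continuous (evalP x) := by
  by_cases hc : -h ≤ T
  · have : evalP x = fun τ => x (Set.projIcc (-h) T hc τ) := funext (evalP_eq hc x)
    rw [this]
    exact x.continuous.comp continuous_projIcc
  · have : evalP x = fun τ => 0 := by funext τ; simp [evalP, hc]
    rw [this]; exact continuous_const

lemma continuous_evalP' (τ : ℝ) : Continuous (fun x : PathSp n h T => evalP x τ) := by
  by_cases hc : -h ≤ T
  · simp only [evalP_eq hc]
    exact continuous_eval_const _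
  · simp [evalP, hc]; exact continuous_const

lemma norm_evalP_le (x : PathSp n h T) (τ : ℝ) : ‖evalP x τ‖ ≤ ‖x‖ := by
  by_cases hc : -h ≤ T
  · rw [evalP_eq hc]; exact x.norm_coe_le_norm _
  · simp [evalP, hc]

lemma evalP_sub (x y : PathSp n h T) (τ : ℝ) : evalP (x - y) τ = evalP x τ - evalP y τ := by
  by_cases hc : -h ≤ T
  · simp [evalP_eq hc]
  · simp [evalP, hc]

lemma evalP_stopped (hc : -h ≤ T) (x : PathSp n h T) {t : ℝ} (ht : -h ≤ t) (τ : ℝ) :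
    evalP (stopPath t x) τ = evalP x (min τ t) := by
  rw [evalP_eq hc, evalP_eq hc]
  simp only [stopPath, ContinuousMap.comp_apply, ContinuousMap.coe_mk]
  congr 1
  apply Subtype.ext
  simp only [stopTime, Set.projIcc]
  grind

lemma evalP_ext {x y : PathSp n h T} (hxy : ∀ s, evalP x s = evalP y s) : x = y := by
  ext1 s
  rw [← evalP_val, ← evalP_val, hxy]

lemma stopPath_sub (t : ℝ) (x y : PathSp n h T) :
    stopPath t (x - y) = stopPath t x - stopPath t y := rfl

lemma norm_stopPath_le (t : ℝ) (x : PathSp n h T) : ‖stopPath t x‖ ≤ ‖x‖ := by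
  rw [ContinuousMap.norm_le _ (norm_nonneg _)]
  intro s
  exact x.norm_coe_le_norm _

lemma stopPath_stopPath (hc : -h ≤ T) {a b : ℝ} (ha : -h ≤ a) (hab : a ≤ b)
    (x : PathSp n h T) : stopPath a (stopPath b x) = stopPath a x := by
  apply evalP_ext
  intro s
  rw [evalP_stopped hc _ ha, evalP_stopped hc _ (ha.trans hab), evalP_stopped hc _ ha]
  congr 1
  grind

lemma norm_stopPath_mono (hc : -h ≤ T) {a b : ℝ} (ha : -h ≤ a) (hab : a ≤ b)
    (x : PathSp n h T) : ‖stopPath a x‖ ≤ ‖stopPath b x‖ := by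
  rw [← stopPath_stopPath hc ha hab]
  exact norm_stopPath_le _ _

lemma stop_eq_iff (hc : -h ≤ T) {t : ℝ} (ht : -h ≤ t) (x y : PathSp n h T) :
    stopPath t x = stopPath t y ↔ ∀ s ≤ t, evalP x s = evalP y s := by
  constructor
  · intro hxy s hs
    have := congrArg (fun z => evalP z s) hxy
    simpa [evalP_stopped hc _ ht, min_eq_left hs] using this
  · intro hxy
    apply evalP_ext
    intro s
    rw [evalP_stopped hc _ ht, evalP_stopped hc _ ht]
    exact hxy _ (min_le_right _ _)

lemma continuous_stopPath_time (x : PathSp n h T) :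
    Continuous (fun t : ℝ => stopPath t x) := by
  apply ContinuousMap.continuous_of_continuous_uncurry
  have : Continuous (fun p : ℝ × Set.Icc (-h) T => stopTime h T p.1 p.2) := by
    unfold stopTime
    apply Continuous.subtype_mk
    fun_prop
  exact x.continuous.comp this

lemma norm_le_sum (v : Euc n) : ‖v‖ ≤ ∑ i, |v i| := by
  have h1 : v = ∑ i, (v i) • EuclideanSpace.single i (1:ℝ) := by
    ext j
    simp [Pi.single_apply]
  calc ‖v‖ = ‖∑ i, (v i) • EuclideanSpace.single i (1:ℝ)‖ := by rw [← h1]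
    _ ≤ ∑ i, ‖(v i) • EuclideanSpace.single i (1:ℝ)‖ := norm_sum_le _ _
    _ = _ := by simp [norm_smul]

lemma ac_scalar {f c : ℝ → ℝ} (hc : Integrable c)
    (hf : ∀ a b, a ≤ b → |f b - f a| ≤ ∫ ξ in a..b, c ξ) :
    (∀ a b, IntervalIntegrable (deriv f) volume a b) ∧
    (∀ a b, ∫ ξ in a..b, deriv f ξ = f b - f a) ∧
    (∀ᵐ ξ, |deriv f ξ| ≤ c ξ) := by
  have hci : ∀ a b, IntervalIntegrable c volume a b := fun a b => hc.intervalIntegrable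
  have hdist : ∀ a p q : ℝ, dist (f p) (f q) ≤ dist (∫ ξ in a..p, c ξ) (∫ ξ in a..q, c ξ) := by
    have key : ∀ a p q : ℝ, p ≤ q →
        dist (f p) (f q) ≤ dist (∫ ξ in a..p, c ξ) (∫ ξ in a..q, c ξ) := by
      intro a p q hpq
      rw [dist_comm (f p), dist_comm (∫ ξ in a..p, c ξ), Real.dist_eq, Real.dist_eq,
        intervalIntegral.integral_interval_sub_left (hci _ _) (hci _ _)]
      exact (hf p q hpq).trans (le_abs_self _)
    intro a p q
    rcases le_total p q with hpq | hpq
    · exact key a p q hpq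
    · rw [dist_comm (f p), dist_comm (∫ ξ in a..p, c ξ)]; exact key a q p hpq
  have hac : ∀ a b, AbsolutelyContinuousOnInterval f a b := by
    intro a b
    have hG := (hci a b).absolutelyContinuousOnInterval_intervalIntegral (c := a) (by simp)
    rw [absolutelyContinuousOnInterval_iff] at hG ⊢
    intro ε hε
    obtain ⟨δ, hδ, hG⟩ := hG ε hε
    refine ⟨δ, hδ, fun E hE hE' => lt_of_le_of_lt ?_ (hG E hE hE')⟩
    exact Finset.sum_le_sum fun i _ => hdist a _ _
  refine ⟨fun a b => (hac a b).intervalIntegrable_deriv, fun a b => (hac a b).integral_deriv_eq_sub, ?_⟩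
  filter_upwards [_root_.LocallyIntegrable.ae_hasDerivAt_integral hc.locallyIntegrable] with ξ hξ
  by_cases hd : DifferentiableAt ℝ f ξ
  · have h1 := (hasDerivAt_iff_tendsto_slope.1 hd.hasDerivAt).mono_left
      (nhdsWithin_mono ξ (show Set.Ioi ξ ⊆ {ξ}ᶜ from fun y hy => ne_of_gt hy))
    have h2 := (hasDerivAt_iff_tendsto_slope.1 (hξ ξ)).mono_left
      (nhdsWithin_mono ξ (show Set.Ioi ξ ⊆ {ξ}ᶜ from fun y hy => ne_of_gt hy))
    refine le_of_tendsto_of_tendsto h1.abs h2 ?_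
    filter_upwards [self_mem_nhdsWithin] with y hy
    have hy' : 0 < y - ξ := sub_pos.2 hy
    simp only [slope_def_field, intervalIntegral.integral_same, sub_zero, abs_div, abs_of_pos hy']
    have := hf ξ y hy.le
    gcongr
  · rw [deriv_zero_of_not_differentiableAt hd, abs_zero]
    have h2 := (hasDerivAt_iff_tendsto_slope.1 (hξ ξ)).mono_left
      (nhdsWithin_mono ξ (show Set.Ioi ξ ⊆ {ξ}ᶜ from fun y hy => ne_of_gt hy))
    refine ge_of_tendsto h2 ?_
    filter_upwards [self_mem_nhdsWithin] with y hy
    have hy' : 0 < y - ξ := sub_pos.2 hy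
    simp only [slope_def_field, intervalIntegral.integral_same, sub_zero]
    have := (abs_nonneg _).trans (hf ξ y hy.le)
    positivity

lemma ac_vec {f : ℝ → Euc n} {c : ℝ → ℝ} (hc : Integrable c)
    (hf : ∀ a b, a ≤ b → ‖f b - f a‖ ≤ ∫ ξ in a..b, c ξ) :
    ∃ f' : ℝ → Euc n, (∀ a b, IntervalIntegrable f' volume a b) ∧
    (∀ a b, ∫ ξ in a..b, f' ξ = f b - f a) ∧
    (∀ᵐ ξ, ‖f' ξ‖ ≤ n * c ξ) := by
  have hs : ∀ i : Fin n, _ := fun i => ac_scalar (f := fun t => f t i) hc (fun a b hab => by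
    refine le_trans ?_ (hf a b hab)
    have := PiLp.norm_apply_le (f b - f a) i
    simpa using this)
  let f' : ℝ → Euc n := fun ξ => ∑ i, (deriv (fun t => f t i) ξ) • EuclideanSpace.single i (1:ℝ)
  have hii : ∀ i a b, IntervalIntegrable
      (fun ξ => (deriv (fun t => f t i) ξ) • (EuclideanSpace.single i (1:ℝ) : Euc n)) volume a b := by
    intro i a b
    have := (hs i).1 a b
    exact ⟨this.1.smul_const _, this.2.smul_const _⟩
  refine ⟨f', fun a b => ?_, fun a b => ?_, ?_⟩
  · have := IntervalIntegrable.sum Finset.univ fun i _ => hii i a b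
    have e : (∑ i, fun ξ => (deriv (fun t => f t i) ξ) • (EuclideanSpace.single i (1:ℝ) : Euc n))
        = f' := by
      funext ξ
      simp [f']
    rw [e] at this
    exact this
  · simp only [f']
    rw [intervalIntegral.integral_finsetSum (fun i _ => hii i a b)]
    simp only [intervalIntegral.integral_smul_const, (hs _).2.1]
    ext j
    simp [Pi.single_apply]
  · filter_upwards [ae_all_iff.2 fun i => (hs i).2.2] with ξ hξ
    calc ‖f' ξ‖ ≤ ∑ i, ‖(deriv (fun t => f t i) ξ) • (EuclideanSpace.single i (1:ℝ) : Euc n)‖ :=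
          norm_sum_le _ _
      _ ≤ ∑ i : Fin n, c ξ := by
          apply Finset.sum_le_sum
          intro i _
          simpa [norm_smul] using hξ i
      _ = n * c ξ := by simp

end Helpers

section Compactness
variable {n : ℕ} {h T : ℝ}

lemma compact_inc (hc : -h ≤ T) {t : ℝ} (ht : -h ≤ t) (htT : t ≤ T) (x : PathSp n h T) {k : ℝ → ℝ}
    (hk : Integrable k) (hk0 : ∀ ξ, 0 ≤ k ξ) :
    IsCompact {y : PathSp n h T | (∀ s ≤ t, evalP y s = evalP x s) ∧
      ∀ a b, t ≤ a → a ≤ b → b ≤ T → ‖evalP y b - evalP y a‖ ≤ ∫ ξ in a..b, k ξ} := by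
  set K := {y : PathSp n h T | (∀ s ≤ t, evalP y s = evalP x s) ∧
      ∀ a b, t ≤ a → a ≤ b → b ≤ T → ‖evalP y b - evalP y a‖ ≤ ∫ ξ in a..b, k ξ} with hK
  have hki : ∀ a b, IntervalIntegrable k volume a b := fun a b => hk.intervalIntegrable
  have hcl : IsClosed K := by
    rw [hK, Set.setOf_and]
    apply IsClosed.inter
    · simp only [Set.setOf_forall]
      exact isClosed_iInter fun s => isClosed_iInter fun _ =>
        isClosed_eq (continuous_evalP' s) continuous_const
    · simp only [Set.setOf_forall]
      exact isClosed_iInter fun a => isClosed_iInter fun b => isClosed_iInter fun _ =>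
        isClosed_iInter fun _ => isClosed_iInter fun _ =>
        isClosed_le ((continuous_evalP' b).sub (continuous_evalP' a)).norm continuous_const
  let e := ContinuousMap.isometryEquivBoundedOfCompact (Set.Icc (-h) T) (Euc n)
  have himg : K = e.symm '' (e.symm ⁻¹' K) := (Set.image_preimage_eq _ e.symm.surjective).symm
  rw [himg]
  refine IsCompact.image ?_ e.symm.continuous
  refine BoundedContinuousFunction.arzela_ascoli₂
    (Metric.closedBall (0 : Euc n) (‖x‖ + ∫ ξ, k ξ)) (isCompact_closedBall _ _) _
    (hcl.preimage e.symm.continuous) ?_ ?_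
  · intro f s hf
    have hf' : e.symm f ∈ K := hf
    have hval : f s = evalP (e.symm f) s.1 := by rw [evalP_val]; rfl
    rw [mem_closedBall_zero_iff, hval]
    have hint : 0 ≤ ∫ ξ, k ξ := integral_nonneg hk0
    rcases le_total s.1 t with hs | hs
    · rw [hf'.1 _ hs]
      have := norm_evalP_le x s.1
      linarith
    · have h1 := hf'.2 t s.1 le_rfl hs s.2.2
      have h2 : ∫ ξ in t..s.1, k ξ ≤ ∫ ξ, k ξ := by
        rw [intervalIntegral.integral_of_le hs]
        exact setIntegral_le_integral hk (Filter.Eventually.of_forall hk0)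
      have h3 := norm_evalP_le x t
      rw [← hf'.1 t le_rfl] at h3
      have h4 : ‖evalP (e.symm f) s.1‖ ≤
        ‖evalP (e.symm f) s.1 - evalP (e.symm f) t‖ + ‖evalP (e.symm f) t‖ := by
        simpa using norm_add_le (evalP (e.symm f) s.1 - evalP (e.symm f) t) (evalP (e.symm f) t)
      linarith
  · intro s0
    have hG : Continuous (fun r => ∫ ξ in t..r, k ξ) :=
      intervalIntegral.continuous_primitive (fun a b => hki a b) t
    refine Metric.equicontinuousAt_of_continuity_modulus
      (fun s : Set.Icc (-h) T => ‖evalP x (min s0.1 t) - evalP x (min s.1 t)‖ +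
        |(∫ ξ in t..(max s0.1 t), k ξ) - (∫ ξ in t..(max s.1 t), k ξ)|) ?_ _ ?_
    · have hcont : Continuous (fun s : Set.Icc (-h) T => ‖evalP x (min s0.1 t) - evalP x (min s.1 t)‖ +
        |(∫ ξ in t..(max s0.1 t), k ξ) - (∫ ξ in t..(max s.1 t), k ξ)|) := by
        apply Continuous.add
        · exact (continuous_const.sub ((continuous_evalP x).comp (by fun_prop))).norm
        · exact (continuous_const.sub (hG.comp (by fun_prop))).abs
      have := hcont.tendsto s0
      simpa using this
    · refine Filter.Eventually.of_forall fun s f => ?_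
      have hf' : e.symm f.1 ∈ K := f.2
      have hval : ∀ s, f.1 s = evalP (e.symm f.1) s.1 := fun s => by rw [evalP_val]; rfl
      set y := e.symm f.1
      have hsplit : ∀ r : ℝ, evalP y r = evalP y (min r t) + evalP y (max r t) - evalP y t := by
        intro r
        rcases le_total r t with hr | hr <;> simp [hr]
      have hmax : ∀ p q : ℝ, t ≤ p → t ≤ q → p ≤ T → q ≤ T → ‖evalP y p - evalP y q‖ ≤
          |(∫ ξ in t..p, k ξ) - ∫ ξ in t..q, k ξ| := by
        intro p q hp hq hpT hqT
        rcases le_total p q with hpq | hpq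
        · rw [norm_sub_rev, abs_sub_comm,
            intervalIntegral.integral_interval_sub_left (hki _ _) (hki _ _)]
          exact (hf'.2 p q hp hpq hqT).trans (le_abs_self _)
        · rw [intervalIntegral.integral_interval_sub_left (hki _ _) (hki _ _)]
          exact (hf'.2 q p hq hpq hpT).trans (le_abs_self _)
      rw [hval, hval, dist_eq_norm, hsplit s0.1, hsplit s.1, hf'.1 _ (min_le_right s0.1 t),
        hf'.1 _ (min_le_right s.1 t)]
      refine le_trans (le_of_eq ?_) ((norm_add_le _ _).trans (add_le_add le_rfl
        (hmax (max s0.1 t) (max s.1 t) (le_max_right _ _) (le_max_right _ _)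
          (max_le s0.2.2 htT) (max_le s.2.2 htT))))
      congr 1
      abel

/-- Integrated form of the velocity bound. -/
def IncB (c : ℝ → ℝ) (t : ℝ) (y : PathSp n h T) : Prop :=
  ∀ a b, t ≤ a → a ≤ b → b ≤ T →
    ‖evalP y b - evalP y a‖ ≤ (1 + ‖stopPath b y‖) * ∫ ξ in a..b, c ξ

lemma incB_of_YPair (hc : -h ≤ T) {t : ℝ} (ht : -h ≤ t) {x : PathSp n h T} {c : ℝ → ℝ}
    (hci : Integrable c) (hc0 : ∀ ξ, 0 ≤ c ξ) {p : PathSp n h T × (ℝ → Euc n)}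
    (hp : p ∈ YPair t x c) : IncB c t p.1 := by
  intro a b hta hab hbT
  obtain ⟨⟨h1, h2, h3⟩, h4⟩ := hp
  have i1 : IntervalIntegrable p.2 volume t a :=
    h2.mono_set (by rw [uIcc_of_le hta, uIcc_of_le (by linarith)]; exact Icc_subset_Icc le_rfl (by linarith))
  have i2 : IntervalIntegrable p.2 volume t b :=
    h2.mono_set (by rw [uIcc_of_le (by linarith), uIcc_of_le (by linarith)]; exact Icc_subset_Icc le_rfl (by linarith))
  rw [h3 b ⟨by linarith, hbT⟩, h3 a ⟨hta, by linarith⟩, add_sub_add_left_eq_sub,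
    intervalIntegral.integral_interval_sub_left i2 i1, ← intervalIntegral.integral_const_mul]
  apply intervalIntegral.norm_integral_le_of_norm_le hab
  · have h5 := (ae_restrict_iff' measurableSet_Icc).1 h4
    filter_upwards [h5] with ξ hξ hξ'
    have := hξ ⟨by linarith [hξ'.1], by linarith [hξ'.2]⟩
    rw [mul_comm]
    refine this.trans ?_
    have := norm_stopPath_mono hc (by linarith [hξ'.1] : -h ≤ ξ) hξ'.2 p.1
    have := hc0 ξ
    gcongr
  · exact (hci.const_mul _).intervalIntegrable

lemma incB_concat (hc : -h ≤ T) {t r : ℝ} (ht : -h ≤ t) (htr : t ≤ r) {y z : PathSp n h T} {c : ℝ → ℝ}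
    (hci : Integrable c) (hc0 : ∀ ξ, 0 ≤ c ξ) (hy : IncB c t y) (hz : IncB c r z)
    (hyz : stopPath r z = stopPath r y) : IncB c t z := by
  have hki : ∀ a b, IntervalIntegrable c volume a b := fun a b => hci.intervalIntegrable
  have hev := (stop_eq_iff hc (ht.trans htr) z y).1 hyz
  have early : ∀ a b, t ≤ a → a ≤ b → b ≤ T → b ≤ r →
      ‖evalP z b - evalP z a‖ ≤ (1 + ‖stopPath b z‖) * ∫ ξ in a..b, c ξ := by
    intro a b hta hab hbT hbr
    rw [hev b hbr, hev a (hab.trans hbr), ← stopPath_stopPath hc (by linarith) hbr z, hyz,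
      stopPath_stopPath hc (by linarith) hbr y]
    exact hy a b hta hab hbT
  intro a b hta hab hbT
  rcases le_total b r with hbr | hbr
  · exact early a b hta hab hbT hbr
  rcases le_total r a with hra | hra
  · exact hz a b hra hab hbT
  have e1 := early a r hta hra (by linarith) le_rfl
  have e2 := hz r b le_rfl hbr hbT
  have e3 := norm_stopPath_mono hc (ht.trans htr) hbr z
  have e4 : 0 ≤ ∫ ξ in a..r, c ξ := intervalIntegral.integral_nonneg hra fun ξ _ => hc0 ξ
  rw [← intervalIntegral.integral_add_adjacent_intervals (hki a r) (hki r b), mul_add]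
  have e5 : ‖evalP z b - evalP z a‖ ≤ ‖evalP z r - evalP z a‖ + ‖evalP z b - evalP z r‖ := by
    rw [add_comm]
    simpa using norm_add_le (evalP z b - evalP z r) (evalP z r - evalP z a)
  have e6 : (1 + ‖stopPath r z‖) * ∫ ξ in a..r, c ξ ≤ (1 + ‖stopPath b z‖) * ∫ ξ in a..r, c ξ := by
    gcongr
  linarith

end Compactness

section OneSided
variable {n : ℕ} {h T : ℝ}

lemma intF_diff (hc : -h ≤ T) (hh : 0 ≤ h) {F : ℝ → PathSp n h T → ℝ} {y₁ y₂ : PathSp n h T}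
    (hF₁ : IntegrableOn (fun ξ => F ξ y₁) (Icc 0 T))
    (hF₂ : IntegrableOn (fun ξ => F ξ y₂) (Icc 0 T)) {lam : ℝ → ℝ}
    (hl : Integrable lam) (hl0 : ∀ ξ, 0 ≤ lam ξ)
    (hlip : ∀ᵐ ξ ∂(volume.restrict (Icc 0 T)), |F ξ y₁ - F ξ y₂| ≤
      lam ξ * ‖stopPath ξ y₁ - stopPath ξ y₂‖) {a b : ℝ} (ha : 0 ≤ a) (hab : a ≤ b) (hb : b ≤ T) :
    |(∫ ξ in a..b, F ξ y₁) - ∫ ξ in a..b, F ξ y₂| ≤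
      (∫ ξ in a..b, lam ξ) * ‖stopPath b y₁ - stopPath b y₂‖ := by
  have hsub : uIoc a b ⊆ Icc 0 T := by
    rw [uIoc_of_le hab]; exact fun ξ hξ => ⟨by linarith [hξ.1], by linarith [hξ.2]⟩
  have i1 : IntervalIntegrable (fun ξ => F ξ y₁) volume a b :=
    intervalIntegrable_iff.2 (hF₁.mono_set hsub)
  have i2 : IntervalIntegrable (fun ξ => F ξ y₂) volume a b :=
    intervalIntegrable_iff.2 (hF₂.mono_set hsub)
  rw [← intervalIntegral.integral_sub i1 i2, ← intervalIntegral.integral_mul_const,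
    ← Real.norm_eq_abs]
  apply intervalIntegral.norm_integral_le_of_norm_le hab
  · have h5 := (ae_restrict_iff' measurableSet_Icc).1 hlip
    filter_upwards [h5] with ξ hξ hξ'
    rw [Real.norm_eq_abs]
    refine (hξ ⟨by linarith [hξ'.1], by linarith [hξ'.2]⟩).trans ?_
    have h6 := norm_stopPath_mono hc (by linarith [hξ'.1] : -h ≤ ξ) hξ'.2 (y₁ - y₂)
    rw [stopPath_sub, stopPath_sub] at h6
    exact mul_le_mul_of_nonneg_left h6 (hl0 ξ)
  · exact (hl.mul_const _).intervalIntegrable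

/-- The local Lipschitz hypothesis on `F`, together with a bound on averages at `t`. -/
def FLip (F : ℝ → PathSp n h T → ℝ) (t : ℝ) : Prop :=
  ∀ N : ℝ, ∃ lam : ℝ → ℝ, Integrable lam ∧ (∀ ξ, 0 ≤ lam ξ) ∧
    (∃ C : ℝ, ∀ᶠ τ in 𝓝[>] t, ∫ ξ in t..τ, lam ξ ≤ C * (τ - t)) ∧
    ∀ y₁ y₂ : PathSp n h T, ‖y₁‖ ≤ N → ‖y₂‖ ≤ N →
      ∀ᵐ ξ ∂(volume.restrict (Icc 0 T)), |F ξ y₁ - F ξ y₂| ≤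
        lam ξ * ‖stopPath ξ y₁ - stopPath ξ y₂‖

/-- One-sided characteristic inequality at `τ`. -/
def QIneq (F : ℝ → PathSp n h T → ℝ) (φ : ℝ → PathSp n h T → ℝ) (s : Euc n) (t : ℝ)
    (x : PathSp n h T) (τ : ℝ) (y : PathSp n h T) : Prop :=
  φ τ y - @inner ℝ _ _ s (evalP y τ - evalP x t) + ∫ ξ in t..τ, F ξ y ≤ φ t x

lemma intF_congr (hc : -h ≤ T) (hh : 0 ≤ h) {F : ℝ → PathSp n h T → ℝ} {t : ℝ}
    (hF : ∀ y, IntegrableOn (fun ξ => F ξ y) (Icc 0 T)) (hL : FLip F t)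
    {y z : PathSp n h T} {a b : ℝ} (ha : 0 ≤ a) (hab : a ≤ b) (hb : b ≤ T)
    (hyz : stopPath b z = stopPath b y) : ∫ ξ in a..b, F ξ z = ∫ ξ in a..b, F ξ y := by
  obtain ⟨lam, h1, h2, -, h3⟩ := hL (max ‖z‖ ‖y‖)
  have := intF_diff hc hh (hF z) (hF y) h1 h2 (h3 z y (le_max_left _ _) (le_max_right _ _)) ha hab hb
  rw [hyz, sub_self, norm_zero, mul_zero] at this
  exact sub_eq_zero.1 (abs_nonpos_iff.1 this)

lemma QIneq_congr (hc : -h ≤ T) (hh : 0 ≤ h) {F : ℝ → PathSp n h T → ℝ}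
    {φ : ℝ → PathSp n h T → ℝ} {s : Euc n} {t : ℝ} (ht : 0 ≤ t) {x : PathSp n h T}
    (hNA : NonAnticipative φ)
    (hF : ∀ y, IntegrableOn (fun ξ => F ξ y) (Icc 0 T)) (hL : FLip F t)
    {y z : PathSp n h T} {τ : ℝ} (htτ : t ≤ τ) (hτ : τ ≤ T)
    (hyz : stopPath τ z = stopPath τ y) (hQ : QIneq F φ s t x τ y) : QIneq F φ s t x τ z := by
  unfold QIneq at *
  rw [intF_congr hc hh hF hL ht htτ hτ hyz, hNA τ ⟨ht.trans htτ, hτ⟩ z, hyz,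
    ← hNA τ ⟨ht.trans htτ, hτ⟩ y, (stop_eq_iff hc (by linarith) z y).1 hyz τ le_rfl]
  exact hQ

lemma chain (hc : -h ≤ T) (hh : 0 ≤ h) {F : ℝ → PathSp n h T → ℝ}
    {φ : ℝ → PathSp n h T → ℝ} {s : Euc n} {t : ℝ} (ht : 0 ≤ t) (htT : t < T) {x : PathSp n h T}
    (hNA : NonAnticipative φ)
    (hF : ∀ y, IntegrableOn (fun ξ => F ξ y) (Icc 0 T)) (hL : FLip F t)
    {c : ℝ → ℝ} (hci : Integrable c) (hc0 : ∀ ξ, 0 ≤ c ξ)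
    (hU : ∀ t ∈ Ico 0 T, ∀ x, ∀ τ ∈ Ioc t T, ∃ y, stopPath t y = stopPath t x ∧ IncB c t y ∧
      QIneq F φ s t x τ y)
    {τ : ℕ → ℝ} (hτ : StrictAnti τ) (hτ1 : ∀ j, t < τ j) (hτ2 : ∀ j, τ j ≤ T) :
    ∀ K j : ℕ, ∃ y, stopPath t y = stopPath t x ∧ IncB c t y ∧
      ∀ i, j ≤ i → i ≤ j + K → QIneq F φ s t x (τ i) y := by
  intro K
  induction K with
  | zero =>
    intro j
    obtain ⟨y, h1, h2, h3⟩ := hU t ⟨ht, htT⟩ x (τ j) ⟨hτ1 j, hτ2 j⟩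
    refine ⟨y, h1, h2, fun i hi1 hi2 => ?_⟩
    have : i = j := by omega
    rw [this]; exact h3
  | succ K ih =>
    intro j
    obtain ⟨y, h1, h2, h3⟩ := ih (j + 1)
    have hlt : τ (j+1) < τ j := hτ (Nat.lt_succ_self j)
    have hr0 : 0 ≤ τ (j+1) := ht.trans (hτ1 _).le
    have hrh : -h ≤ τ (j+1) := by linarith
    obtain ⟨z, g1, g2, g3⟩ := hU (τ (j+1)) ⟨hr0, hlt.trans_le (hτ2 j)⟩ y (τ j) ⟨hlt, hτ2 j⟩
    refine ⟨z, ?_, incB_concat hc (by linarith) (hτ1 _).le hci hc0 h2 g2 g1, ?_⟩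
    · rw [← stopPath_stopPath hc (by linarith) (hτ1 (j+1)).le z, g1,
        stopPath_stopPath hc (by linarith) (hτ1 (j+1)).le y, h1]
    · have hcase : ∀ i, j + 1 ≤ i → i ≤ j + 1 + K → QIneq F φ s t x (τ i) z := by
        intro i hi1 hi2
        have hle : τ i ≤ τ (j+1) := hτ.antitone hi1
        refine QIneq_congr hc hh ht hNA hF hL (hτ1 i).le (hτ2 i) ?_ (h3 i hi1 hi2)
        rw [← stopPath_stopPath hc (by linarith [hτ1 i]) hle z, g1,
          stopPath_stopPath hc (by linarith [hτ1 i]) hle y]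
      intro i hi1 hi2
      rcases Nat.eq_or_lt_of_le hi1 with rfl | hlt'
      · have hQ := hcase (j+1) le_rfl (by omega)
        have hQy := h3 (j+1) le_rfl (by omega)
        unfold QIneq at *
        have hadd : (∫ ξ in t..τ (j+1), F ξ z) + ∫ ξ in τ (j+1)..τ j, F ξ z = ∫ ξ in t..τ j, F ξ z := by
          apply intervalIntegral.integral_add_adjacent_intervals
          · refine intervalIntegrable_iff.2 ((hF z).mono_set ?_)
            rw [uIoc_of_le (hτ1 _).le]
            exact fun ξ hξ => ⟨by linarith [hξ.1], hξ.2.trans (hτ2 _)⟩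
          · refine intervalIntegrable_iff.2 ((hF z).mono_set ?_)
            rw [uIoc_of_le hlt.le]
            exact fun ξ hξ => ⟨by linarith [hξ.1], hξ.2.trans (hτ2 _)⟩
        have hcg := intF_congr hc hh hF hL ht (hτ1 _).le (hτ2 (j+1)) g1
        have hin : @inner ℝ _ _ s (evalP z (τ j) - evalP x t) =
            @inner ℝ _ _ s (evalP z (τ j) - evalP y (τ (j+1))) +
            @inner ℝ _ _ s (evalP y (τ (j+1)) - evalP x t) := by
          rw [← inner_add_right]; congr 1; abel
        rw [← hadd, hin, hcg]
        linarith
      · exact hcase i hlt' (by omega)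

end OneSided

section Limit
variable {n : ℕ} {h T : ℝ}

lemma exists_char (hc : -h ≤ T) (hh : 0 ≤ h) {F : ℝ → PathSp n h T → ℝ}
    {φ : ℝ → PathSp n h T → ℝ} {s : Euc n} {t : ℝ} (ht : 0 ≤ t) (htT : t < T) {x : PathSp n h T}
    (hNA : NonAnticipative φ)
    (hlsc : LowerSemicontinuousOn (fun p : ℝ × PathSp n h T => φ p.1 p.2)
      (Set.Icc 0 T ×ˢ (Set.univ : Set (PathSp n h T))))
    (hF : ∀ y, IntegrableOn (fun ξ => F ξ y) (Icc 0 T)) (hL : FLip F t)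
    {c : ℝ → ℝ} (hci : Integrable c) (hc0 : ∀ ξ, 0 ≤ c ξ)
    (hU : ∀ t ∈ Ico 0 T, ∀ x, ∀ τ ∈ Ioc t T, ∃ y, stopPath t y = stopPath t x ∧ IncB c t y ∧
      QIneq F φ s t x τ y) :
    ∃ τ : ℕ → ℝ, (∀ j, t < τ j) ∧ (∀ j, τ j ≤ T) ∧ Tendsto τ atTop (𝓝[>] t) ∧
      ∃ (z : PathSp n h T) (M : ℝ), 0 ≤ M ∧ stopPath t z = stopPath t x ∧
        (∀ a b, t ≤ a → a ≤ b → b ≤ T → ‖evalP z b - evalP z a‖ ≤ ∫ ξ in a..b, M * c ξ) ∧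
        ∀ i, QIneq F φ s t x (τ i) z := by
  have hki : ∀ a b, IntervalIntegrable c volume a b := fun a b => hci.intervalIntegrable
  have hth : -h ≤ t := by linarith
  have hnn : ∀ a b, a ≤ b → 0 ≤ ∫ ξ in a..b, c ξ := fun a b hab =>
    intervalIntegral.integral_nonneg hab fun ξ _ => hc0 ξ
  -- choice of δ
  obtain ⟨δ, hδ, hδT, hδc⟩ : ∃ δ > 0, t + δ ≤ T ∧ ∫ ξ in t..(t+δ), c ξ ≤ 1/2 := by
    have hG : Continuous (fun r => ∫ ξ in t..r, c ξ) :=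
      intervalIntegral.continuous_primitive (fun a b => hki a b) t
    have h1 : ∀ᶠ r in 𝓝[>] t, ∫ ξ in t..r, c ξ < 1/2 := by
      have h0 := (hG.tendsto t).eventually (gt_mem_nhds (show (∫ ξ in t..t, c ξ) < 1/2 by simp))
      exact nhdsWithin_le_nhds h0
    have h2 : ∀ᶠ r in 𝓝[>] t, r ∈ Ioc t T := Ioc_mem_nhdsGT htT
    obtain ⟨r, hr1, hr2⟩ := (h1.and h2).exists
    refine ⟨r - t, by linarith [hr2.1], by linarith [hr2.2], ?_⟩
    rw [add_sub_cancel]; exact hr1.le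
  let τ : ℕ → ℝ := fun j => t + δ / ((j:ℝ) + 1)
  have hτ1 : ∀ j, t < τ j := fun j => by
    have : 0 < δ / ((j:ℝ) + 1) := by positivity
    simp only [τ]; linarith
  have hτanti : StrictAnti τ := by
    intro i j hij
    have : (i:ℝ) < j := by exact_mod_cast hij
    simp only [τ]
    gcongr
  have hτ0 : τ 0 = t + δ := by simp [τ]
  have hτle : ∀ j, τ j ≤ τ 0 := fun j => hτanti.antitone (Nat.zero_le j)
  have hτ2 : ∀ j, τ j ≤ T := fun j => (hτle j).trans (by rw [hτ0]; exact hδT)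
  have hτlim : Tendsto τ atTop (𝓝[>] t) := by
    apply tendsto_nhdsWithin_iff.2 ⟨?_, Filter.Eventually.of_forall hτ1⟩
    have : Tendsto (fun j : ℕ => δ / ((j:ℝ) + 1)) atTop (𝓝 0) :=
      tendsto_const_nhds.div_atTop (tendsto_atTop_add_const_right _ _ tendsto_natCast_atTop_atTop)
    simpa using this.const_add t
  refine ⟨τ, hτ1, hτ2, hτlim, ?_⟩
  have hch := fun k => chain hc hh ht htT (x := x) hNA hF hL hci hc0 hU hτanti hτ1 hτ2 k 0
  choose y hy1 hy2 hy3 using hch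
  let w : ℕ → PathSp n h T := fun k => stopPath (τ 0) (y k)
  have hτ0h : -h ≤ τ 0 := by linarith [hτ1 0]
  have hwev : ∀ k r, evalP (w k) r = evalP (y k) (min r (τ 0)) := fun k r =>
    evalP_stopped hc _ hτ0h r
  have hyx : ∀ k r, r ≤ t → evalP (y k) r = evalP x r := fun k =>
    (stop_eq_iff hc hth (y k) x).1 (hy1 k)
  have hnormbd : ∀ k b, -h ≤ b → b ≤ τ 0 → ‖stopPath b (y k)‖ ≤ ‖w k‖ := fun k b hb hb' =>
    norm_stopPath_mono hc hb hb' (y k)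
  have hmono : ∀ a b, t ≤ a → a ≤ b → b ≤ τ 0 → ∫ ξ in a..b, c ξ ≤ 1/2 := by
    intro a b hta hab hb
    have h1 := intervalIntegral.integral_add_adjacent_intervals (hki t a) (hki a b)
    have h2 := intervalIntegral.integral_add_adjacent_intervals (hki t b) (hki b (τ 0))
    have h3 := hnn t a hta
    have h4 := hnn b (τ 0) hb
    rw [← hτ0] at hδc
    linarith
  set M := 2 * ‖x‖ + 1 with hM
  have hwM : ∀ k, ‖w k‖ ≤ M := by
    intro k
    have hle : ‖w k‖ ≤ ‖x‖ + (1 + ‖w k‖) * (1/2) := by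
      rw [ContinuousMap.norm_le _ (by positivity)]
      intro r
      rw [← evalP_val, hwev]
      rcases le_total (min r.1 (τ 0)) t with hr | hr
      · rw [hyx k _ hr]
        have := norm_evalP_le x (min r.1 (τ 0))
        have : 0 ≤ (1 + ‖w k‖) * (1/2) := by positivity
        linarith
      · set b := min r.1 (τ 0)
        have hb0 : b ≤ τ 0 := min_le_right _ _
        have h1 := hy2 k t b le_rfl hr (hb0.trans (hτ2 0))
        have h2 := hmono t b le_rfl hr hb0
        have h3 := hnormbd k b (hth.trans hr) hb0
        have h4 : ‖evalP (y k) b‖ ≤ ‖evalP (y k) b - evalP (y k) t‖ + ‖evalP (y k) t‖ := by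
          simpa using norm_add_le (evalP (y k) b - evalP (y k) t) (evalP (y k) t)
        have h5 := norm_evalP_le x t
        rw [← hyx k t le_rfl] at h5
        have h6 : (1 + ‖stopPath b (y k)‖) * ∫ ξ in t..b, c ξ ≤ (1 + ‖w k‖) * (1/2) := by
          have := hnn t b hr
          gcongr
        linarith
    linarith
  have hM0 : 0 ≤ M := by positivity
  have hwK : ∀ k, w k ∈ {y : PathSp n h T | (∀ s ≤ t, evalP y s = evalP x s) ∧
      ∀ a b, t ≤ a → a ≤ b → b ≤ T → ‖evalP y b - evalP y a‖ ≤ ∫ ξ in a..b, (1 + M) * c ξ} := by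
    intro k
    refine ⟨fun r hr => ?_, fun a b hta hab hbT => ?_⟩
    · rw [hwev, hyx k _ (min_le_of_left_le hr), min_eq_left (hr.trans (hτ1 0).le)]
    · rw [hwev, hwev, intervalIntegral.integral_const_mul]
      have h1 := hy2 k (min a (τ 0)) (min b (τ 0)) (le_min hta (hτ1 0).le)
        (min_le_min_right _ hab) (min_le_of_left_le hbT)
      have h2 := hnormbd k (min b (τ 0)) (le_min (by linarith) hτ0h) (min_le_right _ _)
      have h3 := hwM k
      have h4 : ∫ ξ in (min a (τ 0))..(min b (τ 0)), c ξ ≤ ∫ ξ in a..b, c ξ := by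
        rcases le_total b (τ 0) with hb | hb
        · rw [min_eq_left hb, min_eq_left (hab.trans hb)]
        · rcases le_total a (τ 0) with ha | ha
          · rw [min_eq_right hb, min_eq_left ha]
            have := intervalIntegral.integral_add_adjacent_intervals (hki a (τ 0)) (hki (τ 0) b)
            linarith [hnn (τ 0) b hb]
          · rw [min_eq_right hb, min_eq_right ha, intervalIntegral.integral_same]
            exact hnn a b hab
      have h5 := hnn (min a (τ 0)) (min b (τ 0)) (min_le_min_right _ hab)
      refine h1.trans ?_
      gcongr
      exact h2.trans h3
  have hwQ : ∀ k i, i ≤ k → QIneq F φ s t x (τ i) (w k) := by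
    intro k i hi
    refine QIneq_congr hc hh ht hNA hF hL (hτ1 i).le (hτ2 i) ?_ (hy3 k i (Nat.zero_le _) (by omega))
    exact stopPath_stopPath hc (by linarith [hτ1 i]) (hτle i) (y k)
  obtain ⟨z, hz, θ, hθ, hlim⟩ := (compact_inc hc hth htT.le x (hci.const_mul (1 + M))
    (fun ξ => mul_nonneg (by positivity) (hc0 ξ))).tendsto_subseq hwK
  refine ⟨z, 1 + M, by positivity, (stop_eq_iff hc hth z x).2 hz.1, hz.2, fun i => ?_⟩
  have hzM : ‖z‖ ≤ M := le_of_tendsto hlim.norm (Filter.Eventually.of_forall fun k => hwM _)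
  obtain ⟨lam, l1, l2, -, l3⟩ := hL M
  have hi0 : 0 ≤ τ i := ht.trans (hτ1 i).le
  have hintlim : Tendsto (fun k => ∫ ξ in t..τ i, F ξ (w (θ k))) atTop (𝓝 (∫ ξ in t..τ i, F ξ z)) := by
    rw [tendsto_iff_dist_tendsto_zero]
    have hd : Tendsto (fun k => (∫ ξ in t..τ i, lam ξ) * ‖w (θ k) - z‖) atTop (𝓝 0) := by
      have := (tendsto_iff_norm_sub_tendsto_zero.1 hlim).const_mul (∫ ξ in t..τ i, lam ξ)
      simpa using this
    refine squeeze_zero (fun k => dist_nonneg) (fun k => ?_) hd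
    rw [Real.dist_eq]
    refine (intF_diff hc hh (hF _) (hF _) l1 l2 (l3 _ _ (hwM _) hzM) ht (hτ1 i).le (hτ2 i)).trans ?_
    rw [← stopPath_sub]
    have := intervalIntegral.integral_nonneg (μ := volume) (hτ1 i).le fun ξ _ => l2 ξ
    gcongr
    exact norm_stopPath_le _ _
  have hinlim : Tendsto (fun k => @inner ℝ _ _ s (evalP (w (θ k)) (τ i) - evalP x t)) atTop
      (𝓝 (@inner ℝ _ _ s (evalP z (τ i) - evalP x t))) := by
    have hcont : Continuous (fun y : PathSp n h T => @inner ℝ _ _ s (evalP y (τ i) - evalP x t)) :=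
      continuous_const.inner ((continuous_evalP' (τ i)).sub continuous_const)
    exact (hcont.tendsto z).comp hlim
  unfold QIneq
  refine le_of_forall_pos_le_add fun ε hε => ?_
  have hl := hlsc (τ i, z) ⟨⟨hi0, hτ2 i⟩, Set.mem_univ _⟩ (φ (τ i) z - ε) (by simp; exact hε)
  have hpair : Tendsto (fun k => (τ i, w (θ k))) atTop
      (𝓝[Set.Icc 0 T ×ˢ (Set.univ : Set (PathSp n h T))] (τ i, z)) := by
    refine tendsto_nhdsWithin_iff.2 ⟨?_, Filter.Eventually.of_forall fun k =>
      Set.mk_mem_prod ⟨hi0, hτ2 i⟩ (Set.mem_univ _)⟩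
    exact tendsto_const_nhds.prodMk_nhds hlim
  have hev := hpair.eventually hl
  have hfin : Tendsto (fun k => φ t x + @inner ℝ _ _ s (evalP (w (θ k)) (τ i) - evalP x t) -
      ∫ ξ in t..τ i, F ξ (w (θ k))) atTop (𝓝 (φ t x + @inner ℝ _ _ s (evalP z (τ i) - evalP x t) -
      ∫ ξ in t..τ i, F ξ z)) := (hinlim.const_add _).sub hintlim
  have hle : φ (τ i) z - ε ≤ φ t x + @inner ℝ _ _ s (evalP z (τ i) - evalP x t) -
      ∫ ξ in t..τ i, F ξ z := by
    refine ge_of_tendsto hfin ?_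
    filter_upwards [hev, eventually_ge_atTop i] with k hk hki'
    have hQ := hwQ (θ k) i (hki'.trans (hθ.id_le k))
    unfold QIneq at hQ
    have hk' : φ (τ i) z - ε < φ (τ i) (w (θ k)) := hk
    linarith
  linarith

lemma one_sided (hc : -h ≤ T) (hh : 0 ≤ h) {F : ℝ → PathSp n h T → ℝ}
    {φ : ℝ → PathSp n h T → ℝ} {s : Euc n} {t : ℝ} (ht : 0 ≤ t) (htT : t < T) {x : PathSp n h T}
    (hNA : NonAnticipative φ)
    (hlsc : LowerSemicontinuousOn (fun p : ℝ × PathSp n h T => φ p.1 p.2)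
      (Set.Icc 0 T ×ˢ (Set.univ : Set (PathSp n h T))))
    (hF : ∀ y, IntegrableOn (fun ξ => F ξ y) (Icc 0 T)) (hL : FLip F t)
    {c : ℝ → ℝ} (hci : Integrable c) (hc0 : ∀ ξ, 0 ≤ c ξ)
    (hcb : ∃ C : ℝ, ∀ᶠ τ in 𝓝[>] t, ∫ ξ in t..τ, c ξ ≤ C * (τ - t))
    (havg : Tendsto (fun τ => (∫ ξ in t..τ, F ξ x) / (τ - t)) (𝓝[>] t) (𝓝 (F t x)))
    (hU : ∀ t ∈ Ico 0 T, ∀ x, ∀ τ ∈ Ioc t T, ∃ y, stopPath t y = stopPath t x ∧ IncB c t y ∧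
      QIneq F φ s t x τ y) {a : ℝ} (hD : HasCiDeriv φ t x a s) : a + F t x ≤ 0 := by
  obtain ⟨τ, hτ1, hτ2, hτlim, z, M, hM, hzx, hzb, hQ⟩ :=
    exists_char hc hh ht htT (x := x) hNA hlsc hF hL hci hc0 hU
  have hth : -h ≤ t := by linarith
  have hki : ∀ a b, IntervalIntegrable c volume a b := fun a b => hci.intervalIntegrable
  -- derivative of z
  have hglob : ∀ a b, a ≤ b → ‖evalP z (min (max b t) T) - evalP z (min (max a t) T)‖ ≤
      ∫ ξ in a..b, M * c ξ := by
    intro a b hab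
    have h1 := hzb (min (max a t) T) (min (max b t) T) (le_min (le_max_right _ _) htT.le)
      (by gcongr) (min_le_right _ _)
    refine h1.trans ?_
    have hMc : 0 ≤ᵐ[volume.restrict (Ioc a b)] fun ξ => M * c ξ :=
      Filter.Eventually.of_forall fun ξ => mul_nonneg hM (hc0 ξ)
    rcases le_or_gt b t with hbt | hbt
    · rw [max_eq_right hbt, max_eq_right (hab.trans hbt), intervalIntegral.integral_same]
      exact intervalIntegral.integral_nonneg hab fun ξ _ => mul_nonneg hM (hc0 ξ)
    rcases le_or_gt a T with haT | haT
    · exact intervalIntegral.integral_mono_interval (by grind) (by gcongr)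
        (by grind) hMc (hci.const_mul M).intervalIntegrable
    · rw [min_eq_right (by grind), min_eq_right (by grind), intervalIntegral.integral_same]
      exact intervalIntegral.integral_nonneg hab fun ξ _ => mul_nonneg hM (hc0 ξ)
  obtain ⟨z', hz1, hz2, hz3⟩ := ac_vec (f := fun r => evalP z (min (max r t) T))
    (hci.const_mul M) hglob
  have hAC : (z, z') ∈ ACPair t x := by
    refine ⟨hzx, hz1 _ _, fun r hr => ?_⟩
    simp only [hz2]
    simp [max_eq_left hr.1, min_eq_left hr.2, min_eq_left htT.le]
  obtain ⟨o, ho1, ho2⟩ := hD _ hAC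
  obtain ⟨C, hC⟩ := hcb
  -- averages of o
  have hpos : ∀ j, 0 < τ j - t := fun j => sub_pos.2 (hτ1 j)
  have ho : Tendsto (fun j => o (τ j - t) / (τ j - t)) atTop (𝓝 0) := by
    have h1 : Tendsto (fun j => |o (τ j - t) / (τ j - t + ∫ ξ in t..τ j, ‖z' ξ‖)| *
        (1 + n * (M * C))) atTop (𝓝 0) := by
      have := ((ho2.comp hτlim).abs).mul_const (1 + n * (M * C))
      simpa using this
    refine squeeze_zero_norm' ?_ h1
    filter_upwards [hτlim.eventually hC] with j hj
    have hI0 : 0 ≤ ∫ ξ in t..τ j, ‖z' ξ‖ :=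
      intervalIntegral.integral_nonneg (hτ1 j).le fun ξ _ => norm_nonneg _
    have hI : ∫ ξ in t..τ j, ‖z' ξ‖ ≤ n * (M * C) * (τ j - t) := by
      have h2 : ∫ ξ in t..τ j, ‖z' ξ‖ ≤ ∫ ξ in t..τ j, n * (M * c ξ) := by
        apply intervalIntegral.integral_mono_ae (hτ1 j).le (hz1 _ _).norm
          ((hci.const_mul M).const_mul _).intervalIntegrable
        exact hz3
      rw [intervalIntegral.integral_const_mul, intervalIntegral.integral_const_mul] at h2
      refine h2.trans ?_
      rw [mul_assoc, mul_assoc]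
      gcongr
    set I := ∫ ξ in t..τ j, ‖z' ξ‖
    set D := τ j - t
    have hDp : 0 < D := hpos j
    rw [Real.norm_eq_abs, abs_div, abs_div, abs_of_pos hDp, abs_of_pos (by linarith : 0 < D + I),
      div_mul_eq_mul_div, div_le_div_iff₀ hDp (by linarith)]
    have : D + I ≤ (1 + n * (M * C)) * D := by linarith
    calc |o D| * (D + I) ≤ |o D| * ((1 + n * (M * C)) * D) := by gcongr
      _ = _ := by ring
  -- averages of F along z
  have hFz : Tendsto (fun j => (∫ ξ in t..τ j, F ξ z) / (τ j - t)) atTop (𝓝 (F t x)) := by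
    obtain ⟨lam, l1, l2, ⟨C', hC'⟩, l3⟩ := hL (max ‖z‖ ‖x‖)
    have hη : Tendsto (fun j => C' * ‖stopPath (τ j) (z - x)‖) atTop (𝓝 0) := by
      have h1 : Tendsto (fun r => ‖stopPath r (z - x)‖) (𝓝[>] t) (𝓝 0) := by
        have h2 := ((continuous_stopPath_time (z - x)).norm.tendsto t)
        rw [stopPath_sub, hzx, sub_self, norm_zero] at h2
        exact h2.mono_left nhdsWithin_le_nhds
      simpa using (h1.comp hτlim).const_mul C'
    have hdiff : Tendsto (fun j => (∫ ξ in t..τ j, F ξ z) / (τ j - t) -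
        (∫ ξ in t..τ j, F ξ x) / (τ j - t)) atTop (𝓝 0) := by
      refine squeeze_zero_norm' ?_ hη
      filter_upwards [hτlim.eventually hC'] with j hj
      rw [← sub_div, Real.norm_eq_abs, abs_div, abs_of_pos (hpos j), div_le_iff₀ (hpos j)]
      refine (intF_diff hc hh (hF _) (hF _) l1 l2
        (l3 z x (le_max_left _ _) (le_max_right _ _)) ht (hτ1 j).le (hτ2 j)).trans ?_
      rw [← stopPath_sub, mul_right_comm]
      gcongr
    have := hdiff.add (havg.comp hτlim)
    simpa [Function.comp_def] using this
  have hsum : Tendsto (fun j => a + o (τ j - t) / (τ j - t) + (∫ ξ in t..τ j, F ξ z) / (τ j - t))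
      atTop (𝓝 (a + 0 + F t x)) := (ho.const_add a).add hFz
  rw [add_zero] at hsum
  refine le_of_tendsto hsum (Filter.Eventually.of_forall fun j => ?_)
  have hQj := hQ j
  unfold QIneq at hQj
  have hoj := ho1 (τ j) ⟨hτ1 j, hτ2 j⟩
  have hle : a * (τ j - t) + o (τ j - t) + ∫ ξ in t..τ j, F ξ z ≤ 0 := by
    simp only at hoj
    linarith
  have := hpos j
  have heq : a + o (τ j - t) / (τ j - t) + (∫ ξ in t..τ j, F ξ z) / (τ j - t) =
      (a * (τ j - t) + o (τ j - t) + ∫ ξ in t..τ j, F ξ z) / (τ j - t) := by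
    field_simp
  rw [heq]
  exact div_nonpos_of_nonpos_of_nonneg hle this.le

end Limit

section Main
variable {n : ℕ} {h T : ℝ}

lemma ae_le_of_full (hT : 0 < T) {E : Set ℝ} (hE : E ⊆ Icc 0 T) (hv : volume E = ENNReal.ofReal T)
    {f g : ℝ → ℝ} (hf : AEMeasurable f (volume.restrict (Icc 0 T)))
    (hg : AEMeasurable g (volume.restrict (Icc 0 T))) (hfg : ∀ ξ ∈ E, f ξ ≤ g ξ) :
    ∀ᵐ ξ ∂(volume.restrict (Icc 0 T)), f ξ ≤ g ξ := by
  rw [ae_iff_measure_eq (nullMeasurableSet_le hf hg)]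
  apply le_antisymm (measure_mono (subset_univ _))
  rw [Measure.restrict_apply_univ, Real.volume_Icc, sub_zero, ← hv]
  calc volume E = (volume.restrict (Icc 0 T)) E := by
        rw [Measure.restrict_apply' measurableSet_Icc, inter_eq_left.2 hE]
    _ ≤ _ := measure_mono hfg

lemma H_meas {H : ℝ → PathSp n h T → Euc n → ℝ} (hH1 : CondA1 H) (x : PathSp n h T) (s : Euc n) :
    AEMeasurable (fun t => H t x s) (volume.restrict (Icc 0 T)) :=
  aemeasurable_restrict_of_measurable_subtype measurableSet_Icc (hH1 x s)

lemma A3_ae (hT : 0 < T) {H : ℝ → PathSp n h T → Euc n → ℝ} (hH1 : CondA1 H)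
    {D : Set (PathSp n h T)} {lam : ℝ → ℝ} (hA : CondA3For H D lam) {x₁ x₂ : PathSp n h T}
    (h1 : x₁ ∈ D) (h2 : x₂ ∈ D) (s : Euc n) :
    ∀ᵐ ξ ∂(volume.restrict (Icc 0 T)), |H ξ x₁ s - H ξ x₂ s| ≤
        lam ξ * (1 + ‖s‖) * ‖stopPath ξ x₁ - stopPath ξ x₂‖ := by
  obtain ⟨E, hE, hv, hb⟩ := hA.2 x₁ h1 x₂ h2 s
  refine ae_le_of_full hT hE hv ?_ ?_ hb
  · exact continuous_abs.measurable.comp_aemeasurable ((H_meas hH1 x₁ s).sub (H_meas hH1 x₂ s))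
  · have hcont := ((continuous_stopPath_time x₁).sub (continuous_stopPath_time x₂)).norm
    exact (hA.1.1.aestronglyMeasurable.aemeasurable.mul_const _).mul hcont.measurable.aemeasurable

lemma A4_ae (hT : 0 < T) {H : ℝ → PathSp n h T → Euc n → ℝ} (hH1 : CondA1 H)
    {cH : ℝ → ℝ} (hA : CondA4 H cH) (x : PathSp n h T) (s₁ s₂ : Euc n) :
    ∀ᵐ ξ ∂(volume.restrict (Icc 0 T)), |H ξ x s₁ - H ξ x s₂| ≤
        cH ξ * (1 + ‖stopPath ξ x‖) * ‖s₁ - s₂‖ := by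
  obtain ⟨hc, E, hE, hv, hb⟩ := hA
  refine ae_le_of_full hT hE hv ?_ ?_ (fun ξ hξ => hb ξ hξ x s₁ s₂)
  · exact continuous_abs.measurable.comp_aemeasurable ((H_meas hH1 x s₁).sub (H_meas hH1 x s₂))
  · have hcont := continuous_const (y := (1:ℝ)) |>.add (continuous_stopPath_time x).norm
    exact (hc.1.aestronglyMeasurable.aemeasurable.mul hcont.measurable.aemeasurable).mul_const _

lemma A4_ae' (hT : 0 < T) {H : ℝ → PathSp n h T → Euc n → ℝ} (hH1 : CondA1 H)
    {cH : ℝ → ℝ} (hA : CondA4 H cH) (x : PathSp n h T) (s₁ s₂ : Euc n) :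
    ∀ᵐ ξ ∂(volume.restrict (Icc 0 T)), |H ξ x s₁ - H ξ x s₂| ≤
        cH ξ * ((1 + ‖x‖) * ‖s₁ - s₂‖) := by
  filter_upwards [A4_ae hT hH1 hA x s₁ s₂, ae_restrict_mem measurableSet_Icc] with ξ hξ hm
  refine hξ.trans ?_
  rw [mul_assoc]
  have := hA.1.2 ξ hm
  have h2 := norm_stopPath_le ξ x
  gcongr

lemma H_int (hT : 0 < T) {H : ℝ → PathSp n h T → Euc n → ℝ} (hH1 : CondA1 H)
    {cH : ℝ → ℝ} (hA : CondA4 H cH) (hH5 : CondA5 H) (x : PathSp n h T) (s : Euc n) :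
    IntegrableOn (fun ξ => H ξ x s) (Icc 0 T) := by
  obtain ⟨m, hm, hmE⟩ := hH5 {x} isCompact_singleton
  obtain ⟨E, hE, hv, hb⟩ := hmE x rfl
  have h1 : ∀ᵐ ξ ∂(volume.restrict (Icc 0 T)), |H ξ x 0| ≤ m ξ :=
    ae_le_of_full hT hE hv (continuous_abs.measurable.comp_aemeasurable (H_meas hH1 x 0))
      hm.1.aestronglyMeasurable.aemeasurable hb
  have hdom : IntegrableOn (fun ξ => m ξ + cH ξ * ((1 + ‖x‖) * ‖s - 0‖)) (Icc 0 T) :=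
    hm.1.add (hA.1.1.mul_const _)
  refine Integrable.mono' hdom (H_meas hH1 x s).aestronglyMeasurable ?_
  filter_upwards [h1, A4_ae' hT hH1 hA x s 0] with ξ a1 a2
  rw [Real.norm_eq_abs]
  have := abs_add_le (H ξ x s - H ξ x 0) (H ξ x 0)
  rw [sub_add_cancel] at this
  linarith

lemma int_diff_le {f₁ f₂ g : ℝ → ℝ} (h1 : IntegrableOn f₁ (Icc 0 T))
    (h2 : IntegrableOn f₂ (Icc 0 T)) (hg : Integrable g)
    (hb : ∀ᵐ ξ ∂(volume.restrict (Icc 0 T)), |f₁ ξ - f₂ ξ| ≤ g ξ) {a b : ℝ} (ha : 0 ≤ a)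
    (hab : a ≤ b) (hbT : b ≤ T) :
    |(∫ ξ in a..b, f₁ ξ) - ∫ ξ in a..b, f₂ ξ| ≤ ∫ ξ in a..b, g ξ := by
  have hsub : Ioc a b ⊆ Icc 0 T := fun ξ hξ => ⟨by linarith [hξ.1], by linarith [hξ.2]⟩
  have i1 : IntervalIntegrable f₁ volume a b :=
    (intervalIntegrable_iff_integrableOn_Ioc_of_le hab).2 (h1.mono_set hsub)
  have i2 : IntervalIntegrable f₂ volume a b :=
    (intervalIntegrable_iff_integrableOn_Ioc_of_le hab).2 (h2.mono_set hsub)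
  rw [← intervalIntegral.integral_sub i1 i2, ← Real.norm_eq_abs]
  apply intervalIntegral.norm_integral_le_of_norm_le hab _ hg.intervalIntegrable
  have := ae_mono (Measure.restrict_mono hsub le_rfl) hb
  exact (ae_restrict_iff' measurableSet_Ioc).1 this

lemma avg_of_deriv {f : ℝ → ℝ} {t : ℝ}
    (hd : HasDerivAt (fun τ => ∫ ξ in t..τ, f ξ) (f t) t) :
    Tendsto (fun τ => (∫ ξ in t..τ, f ξ) / (τ - t)) (𝓝[>] t) (𝓝 (f t)) := by
  have := (hasDerivAt_iff_tendsto_slope.1 hd).mono_left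
    (nhdsWithin_mono t (fun τ (hτ : t < τ) => ne_of_gt hτ))
  refine this.congr fun τ => ?_
  simp [slope_def_field]

lemma bound_of_avg {f : ℝ → ℝ} {t : ℝ}
    (hd : Tendsto (fun τ => (∫ ξ in t..τ, f ξ) / (τ - t)) (𝓝[>] t) (𝓝 (f t))) :
    ∀ᶠ τ in 𝓝[>] t, ∫ ξ in t..τ, f ξ ≤ (|f t| + 1) * (τ - t) := by
  have h1 : f t < |f t| + 1 := by linarith [le_abs_self (f t)]
  filter_upwards [hd.eventually (gt_mem_nhds h1), self_mem_nhdsWithin] with τ h2 h3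
  have h3' : 0 < τ - t := sub_pos.2 h3
  exact ((div_lt_iff₀ h3').1 h2).le

lemma indic_integrable {f : ℝ → ℝ} (hf : IntegrableOn f (Icc 0 T)) :
    Integrable ((Icc 0 T).indicator f) := by
  rwa [integrable_indicator_iff measurableSet_Icc]

lemma int_indic {f : ℝ → ℝ} {a b : ℝ} (ha : 0 ≤ a) (hab : a ≤ b) (hb : b ≤ T) :
    ∫ ξ in a..b, (Icc 0 T).indicator f ξ = ∫ ξ in a..b, f ξ := by
  apply intervalIntegral.integral_congr
  intro ξ hξ
  rw [uIcc_of_le hab] at hξ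
  have hm : ξ ∈ Icc 0 T := ⟨ha.trans hξ.1, hξ.2.trans hb⟩
  exact indicator_of_mem hm f

lemma havg_all (hT : 0 < T) (hh : 0 ≤ h) {H : ℝ → PathSp n h T → Euc n → ℝ} {cH : ℝ → ℝ}
    (hH1 : CondA1 H) (hH4 : CondA4 H cH) (hH5 : CondA5 H) {lam : ℕ → ℝ → ℝ}
    (hlam : ∀ N : ℕ, CondA3For H (Metric.closedBall 0 (N:ℝ)) (lam N)) {t : ℝ} (ht : 0 ≤ t)
    (htT : t < T) (hA2 : Continuous (fun p : PathSp n h T × Euc n => H t p.1 p.2))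
    (hc : ∃ C : ℝ, ∀ᶠ τ in 𝓝[>] t, ∫ ξ in t..τ, (Icc 0 T).indicator cH ξ ≤ C * (τ - t))
    (hl : ∀ N, ∃ C : ℝ, ∀ᶠ τ in 𝓝[>] t, ∫ ξ in t..τ, (Icc 0 T).indicator (lam N) ξ ≤ C * (τ - t))
    {P : ℕ → PathSp n h T × Euc n} (hP : DenseRange P)
    (hk : ∀ k, Tendsto (fun τ => (∫ ξ in t..τ, (Icc 0 T).indicator
        (fun ξ => H ξ (P k).1 (P k).2) ξ) / (τ - t)) (𝓝[>] t)
        (𝓝 ((Icc 0 T).indicator (fun ξ => H ξ (P k).1 (P k).2) t)))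
    (x : PathSp n h T) (s : Euc n) :
    Tendsto (fun τ => (∫ ξ in t..τ, H ξ x s) / (τ - t)) (𝓝[>] t) (𝓝 (H t x s)) := by
  obtain ⟨N, hN⟩ := exists_nat_gt ‖x‖
  obtain ⟨C₁, hC₁⟩ := hl N
  obtain ⟨C₂, hC₂⟩ := hc
  rw [Metric.tendsto_nhds]
  intro ε hε
  let R : PathSp n h T × Euc n → ℝ := fun p =>
    C₁ * (1 + ‖s‖) * ‖x - p.1‖ + C₂ * ((1 + ‖p.1‖) * ‖s - p.2‖)
  have hR : Continuous R := by fun_prop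
  have e1 : ∀ᶠ p in 𝓝 (x, s), |H t p.1 p.2 - H t x s| < ε / 3 := by
    have : Continuous (fun p : PathSp n h T × Euc n => |H t p.1 p.2 - H t x s|) :=
      (hA2.sub continuous_const).abs
    exact (this.tendsto (x, s)).eventually (gt_mem_nhds (by simp; positivity))
  have e2 : ∀ᶠ p in 𝓝 (x, s), R p < ε / 3 :=
    (hR.tendsto (x, s)).eventually (gt_mem_nhds (by simp [R]; positivity))
  have e3 : ∀ᶠ p : PathSp n h T × Euc n in 𝓝 (x, s), ‖p.1‖ < N := by
    have : Continuous (fun p : PathSp n h T × Euc n => ‖p.1‖) := by fun_prop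
    exact (this.tendsto (x, s)).eventually (gt_mem_nhds (by simpa using hN))
  obtain ⟨k, hk1, hk2, hk3⟩ := hP.mem_nhds (e1.and (e2.and e3))
  have e4 := (Metric.tendsto_nhds.1 (hk k)) (ε / 3) (by positivity)
  set y := (P k).1 with hy
  set q := (P k).2 with hq
  have htm : t ∈ Icc 0 T := ⟨ht, htT.le⟩
  rw [indicator_of_mem htm] at e4
  filter_upwards [hC₁, hC₂, e4, Ioo_mem_nhdsGT htT] with τ b1 b2 b3 b4
  have hτ : 0 < τ - t := sub_pos.2 b4.1
  rw [int_indic ht b4.1.le b4.2.le] at b1 b2 b3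
  have hc' : -h ≤ T := by linarith
  have hll : Integrable (fun ξ => (Icc 0 T).indicator (lam N) ξ * (1 + ‖s‖)) :=
    (indic_integrable (hlam N).1.1).mul_const _
  have d1 := int_diff_le (H_int hT hH1 hH4 hH5 x s) (H_int hT hH1 hH4 hH5 y s)
    (g := fun ξ => (Icc 0 T).indicator (lam N) ξ * ((1 + ‖s‖) * ‖x - y‖))
    ((indic_integrable (hlam N).1.1).mul_const _) (by
      filter_upwards [A3_ae hT hH1 (hlam N) (x₁ := x) (x₂ := y) (by simpa using hN.le)
        (by simpa using hk3.le) s, ae_restrict_mem measurableSet_Icc] with ξ u1 u2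
      refine u1.trans ?_
      rw [indicator_of_mem u2, mul_assoc, ← stopPath_sub]
      have := (hlam N).1.2 ξ u2
      have := norm_stopPath_le ξ (x - y)
      gcongr) ht b4.1.le b4.2.le
  have d2 := int_diff_le (H_int hT hH1 hH4 hH5 y s) (H_int hT hH1 hH4 hH5 y q)
    (g := fun ξ => (Icc 0 T).indicator cH ξ * ((1 + ‖y‖) * ‖s - q‖))
    ((indic_integrable hH4.1.1).mul_const _) (by
      filter_upwards [A4_ae' hT hH1 hH4 y s q, ae_restrict_mem measurableSet_Icc] with ξ u1 u2
      rwa [indicator_of_mem u2]) ht b4.1.le b4.2.le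
  rw [intervalIntegral.integral_mul_const, int_indic ht b4.1.le b4.2.le] at d1 d2
  have d1' : |(∫ ξ in t..τ, H ξ x s) - ∫ ξ in t..τ, H ξ y s| ≤
      C₁ * (τ - t) * ((1 + ‖s‖) * ‖x - y‖) := d1.trans (by gcongr)
  have d2' : |(∫ ξ in t..τ, H ξ y s) - ∫ ξ in t..τ, H ξ y q| ≤
      C₂ * (τ - t) * ((1 + ‖y‖) * ‖s - q‖) := d2.trans (by gcongr)
  have d3 : |(∫ ξ in t..τ, H ξ x s) - ∫ ξ in t..τ, H ξ y q| ≤ R (P k) * (τ - t) := by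
    refine (abs_sub_le _ (∫ ξ in t..τ, H ξ y s) _).trans ((add_le_add d1' d2').trans (le_of_eq ?_))
    simp only [R]
    ring
  have d4 : |(∫ ξ in t..τ, H ξ x s) / (τ - t) - (∫ ξ in t..τ, H ξ y q) / (τ - t)| ≤ R (P k) := by
    rw [← sub_div, abs_div, abs_of_pos hτ, div_le_iff₀ hτ]
    exact d3
  rw [Real.dist_eq] at b3 ⊢
  have d5 := abs_sub_le ((∫ ξ in t..τ, H ξ x s) / (τ - t)) ((∫ ξ in t..τ, H ξ y q) / (τ - t)) (H t x s)
  have d6 := abs_sub_le ((∫ ξ in t..τ, H ξ y q) / (τ - t)) (H t y q) (H t x s)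
  linarith

lemma flip_H (hT : 0 < T) {H : ℝ → PathSp n h T → Euc n → ℝ}
    (hH1 : CondA1 H) {lam : ℕ → ℝ → ℝ}
    (hlam : ∀ N : ℕ, CondA3For H (Metric.closedBall 0 (N:ℝ)) (lam N)) {t : ℝ}
    (hl : ∀ N, ∃ C : ℝ, ∀ᶠ τ in 𝓝[>] t, ∫ ξ in t..τ, (Icc 0 T).indicator (lam N) ξ ≤ C * (τ - t))
    (g : Euc n) : FLip (fun ξ y => H ξ y g) t := by
  intro M
  obtain ⟨N, hN⟩ := exists_nat_ge M
  obtain ⟨C, hC⟩ := hl N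
  refine ⟨fun ξ => (Icc 0 T).indicator (lam N) ξ * (1 + ‖g‖),
    (indic_integrable (hlam N).1.1).mul_const _, fun ξ => ?_, ⟨C * (1 + ‖g‖), ?_⟩, ?_⟩
  · exact mul_nonneg (indicator_nonneg (fun ξ hξ => (hlam N).1.2 ξ hξ) ξ) (by positivity)
  · filter_upwards [hC] with τ hτ
    rw [intervalIntegral.integral_mul_const]
    calc _ ≤ C * (τ - t) * (1 + ‖g‖) := by gcongr
      _ = _ := by ring
  · intro y₁ y₂ h1 h2
    filter_upwards [A3_ae hT hH1 (hlam N) (x₁ := y₁) (x₂ := y₂) (by simpa using h1.trans hN)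
        (by simpa using h2.trans hN) g, ae_restrict_mem measurableSet_Icc] with ξ u1 u2
    rwa [indicator_of_mem u2]

lemma YPair_facts (hc : -h ≤ T) (hh : 0 ≤ h) {cH : ℝ → ℝ} (hcH : IntegNonneg T cH)
    {t : ℝ} (ht : t ∈ Ico 0 T) {x : PathSp n h T} {p : PathSp n h T × (ℝ → Euc n)}
    (hp : p ∈ YPair t x cH) {F : ℝ → ℝ} (hF : IntegrableOn F (Icc 0 T)) (s : Euc n) {τ : ℝ}
    (hτ : τ ∈ Ioc t T) :
    stopPath t p.1 = stopPath t x ∧ IncB ((Icc 0 T).indicator cH) t p.1 ∧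
    ∫ ξ in t..τ, (@inner ℝ _ _ s (p.2 ξ) - F ξ) =
      @inner ℝ _ _ s (evalP p.1 τ - evalP x t) - ∫ ξ in t..τ, F ξ := by
  have hth : -h ≤ t := by linarith [ht.1]
  refine ⟨hp.1.1, ?_, ?_⟩
  · apply incB_of_YPair hc hth (x := x) (indic_integrable hcH.1)
      (fun ξ => indicator_nonneg (fun ξ hξ => hcH.2 ξ hξ) ξ)
    refine ⟨hp.1, ?_⟩
    filter_upwards [hp.2, ae_restrict_mem measurableSet_Icc] with ξ u1 u2
    have hm : ξ ∈ Icc 0 T := ⟨ht.1.trans u2.1, u2.2⟩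
    rwa [indicator_of_mem hm]
  · have i1 : IntervalIntegrable p.2 volume t τ := hp.1.2.1.mono_set (by
      rw [uIcc_of_le hτ.1.le, uIcc_of_le ht.2.le]; exact Icc_subset_Icc le_rfl hτ.2)
    have i2 : IntervalIntegrable F volume t τ :=
      (intervalIntegrable_iff_integrableOn_Ioc_of_le hτ.1.le).2 (hF.mono_set fun ξ hξ =>
        ⟨by linarith [hξ.1, ht.1], by linarith [hξ.2, hτ.2]⟩)
    have i3 : IntervalIntegrable (fun ξ => @inner ℝ _ _ s (p.2 ξ)) volume t τ :=
      ⟨i1.1.const_inner s, i1.2.const_inner s⟩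
    rw [intervalIntegral.integral_sub i3 i2, hp.1.2.2 τ ⟨hτ.1.le, hτ.2⟩,
      (stop_eq_iff hc hth _ _).1 hp.1.1 t le_rfl, add_sub_cancel_left]
    congr 1
    have := (innerSL ℝ s).intervalIntegral_comp_comm i1
    simpa using this

end Main
/-- Theorem on consistency under the strengthened condition
(A.3′) for bounded sets: a minimax solution satisfies the Hamilton–Jacobi
equation a.e. in time, at all paths where it is ci-differentiable. -/
theorem stmt9 {n : ℕ} {h T : ℝ} (hT : 0 < T) (hh : 0 ≤ h)
    (H : ℝ → PathSp n h T → Euc n → ℝ) (cH : ℝ → ℝ)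
    (hH1 : CondA1 H) (hH2 : CondA2 H) (hH4 : CondA4 H cH) (hH5 : CondA5 H)
    (σ : PathSp n h T → ℝ) (hσ : Continuous σ)
    (hH3' : ∀ D : Set (PathSp n h T), Bornology.IsBounded D →
      ∃ lam : ℝ → ℝ, CondA3For H D lam) :
    ∃ E : Set ℝ, E ⊆ Set.Ico 0 T ∧ volume E = ENNReal.ofReal T ∧
      ∀ φ : ℝ → PathSp n h T → ℝ, MinimaxSol H cH σ φ →
        ∀ t ∈ E, ∀ x : PathSp n h T, ∀ (a : ℝ) (g : Euc n),
          HasCiDeriv φ t x a g → a + H t x g = 0 := by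
  have hc : -h ≤ T := by linarith
  obtain ⟨E₂, hE₂, hv, hcont⟩ := hH2
  have hlam' : ∀ N : ℕ, ∃ lam : ℝ → ℝ, CondA3For H (Metric.closedBall 0 (N:ℝ)) lam :=
    fun N => hH3' _ Metric.isBounded_closedBall
  choose lam hlam using hlam'
  let P : ℕ → PathSp n h T × Euc n := TopologicalSpace.denseSeq _
  have hP : DenseRange P := TopologicalSpace.denseRange_denseSeq _
  have hdc := _root_.LocallyIntegrable.ae_hasDerivAt_integral (indic_integrable hH4.1.1).locallyIntegrable
  have hdl := ae_all_iff.2 fun N : ℕ =>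
    _root_.LocallyIntegrable.ae_hasDerivAt_integral
      (indic_integrable (hlam N).1.1).locallyIntegrable
  have hdP := ae_all_iff.2 fun k : ℕ =>
    _root_.LocallyIntegrable.ae_hasDerivAt_integral
      (indic_integrable (H_int hT hH1 hH4 hH5 (P k).1 (P k).2)).locallyIntegrable
  have hne : ∀ᵐ t : ℝ, t ≠ T := by simp [ae_iff]
  have hgood := hdc.and (hdl.and (hdP.and hne))
  let G : Set ℝ := {t | (∀ c, HasDerivAt (fun x => ∫ ξ in c..x, (Icc 0 T).indicator cH ξ)
      ((Icc 0 T).indicator cH t) t) ∧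
    (∀ N : ℕ, ∀ c, HasDerivAt (fun x => ∫ ξ in c..x, (Icc 0 T).indicator (lam N) ξ)
      ((Icc 0 T).indicator (lam N) t) t) ∧
    (∀ k : ℕ, ∀ c, HasDerivAt (fun x => ∫ ξ in c..x, (Icc 0 T).indicator
      (fun ξ => H ξ (P k).1 (P k).2) ξ)
      ((Icc 0 T).indicator (fun ξ => H ξ (P k).1 (P k).2) t) t) ∧ t ≠ T}
  have hG : ∀ᵐ t, t ∈ G := hgood
  refine ⟨E₂ ∩ G, ?_, ?_, ?_⟩
  · rintro t ⟨h1, h2⟩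
    exact ⟨(hE₂ h1).1, lt_of_le_of_ne (hE₂ h1).2 h2.2.2.2⟩
  · rw [← hv]
    apply measure_congr
    filter_upwards [hG] with t ht
    exact propext ⟨fun hh => hh.1, fun hh => ⟨hh, ht⟩⟩
  rintro φ ⟨⟨hNA, hlsc, -, hU⟩, ⟨-, husc, -, hLo⟩⟩ t ⟨htE, g1, g2, g3, g4⟩ x a g hD
  have ht : 0 ≤ t := (hE₂ htE).1
  have htT : t < T := lt_of_le_of_ne (hE₂ htE).2 g4
  have hcb : ∃ C : ℝ, ∀ᶠ τ in 𝓝[>] t, ∫ ξ in t..τ, (Icc 0 T).indicator cH ξ ≤ C * (τ - t) :=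
    ⟨_, bound_of_avg (avg_of_deriv (g1 t))⟩
  have hlb : ∀ N, ∃ C : ℝ, ∀ᶠ τ in 𝓝[>] t,
      ∫ ξ in t..τ, (Icc 0 T).indicator (lam N) ξ ≤ C * (τ - t) :=
    fun N => ⟨_, bound_of_avg (avg_of_deriv (g2 N t))⟩
  have havg := havg_all hT hh hH1 hH4 hH5 hlam ht htT (hcont t htE) hcb hlb hP
    (fun k => avg_of_deriv (g3 k t)) x g
  have hFL := flip_H hT hH1 hlam hlb g
  have hFi : ∀ y, IntegrableOn (fun ξ => H ξ y g) (Icc 0 T) := fun y => H_int hT hH1 hH4 hH5 y g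
  have hci := indic_integrable hH4.1.1
  have hc0 : ∀ ξ, 0 ≤ (Icc 0 T).indicator cH ξ :=
    fun ξ => indicator_nonneg (fun ξ hξ => hH4.1.2 ξ hξ) ξ
  apply le_antisymm
  · refine one_sided (F := fun ξ y => H ξ y g) hc hh ht htT hNA hlsc hFi hFL hci hc0 hcb havg ?_ hD
    intro t' ht' x' τ hτ
    obtain ⟨p, hp, hpi⟩ := hU t' ht' x' g τ hτ
    obtain ⟨q1, q2, q3⟩ := YPair_facts hc hh hH4.1 ht' hp (hFi p.1) g hτ
    refine ⟨p.1, q1, q2, ?_⟩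
    rw [q3] at hpi
    unfold QIneq
    linarith
  · have hfin : -a + -H t x g ≤ 0 := by
      refine one_sided (F := fun ξ y => -H ξ y g) (φ := fun t x => -φ t x) (s := -g)
        hc hh ht htT ?_ ?_ (fun y => (hFi y).neg) ?_ hci hc0 hcb ?_ ?_ ?_
      · intro t ht x
        simp only [neg_inj]
        exact hNA t ht x
      · intro p hp r hr
        have hr' : φ p.1 p.2 < -r := by
          have : r < -φ p.1 p.2 := hr
          linarith
        filter_upwards [husc p hp (-r) hr'] with q hq
        have hq' : φ q.1 q.2 < -r := hq
        show r < -φ q.1 q.2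
        linarith
      · intro N
        obtain ⟨l, l1, l2, l3, l4⟩ := hFL N
        refine ⟨l, l1, l2, l3, fun y₁ y₂ h1 h2 => ?_⟩
        filter_upwards [l4 y₁ y₂ h1 h2] with ξ hξ
        rwa [neg_sub_neg, abs_sub_comm]
      · simpa only [intervalIntegral.integral_neg, neg_div] using havg.neg
      · intro t' ht' x' τ hτ
        obtain ⟨p, hp, hpi⟩ := hLo t' ht' x' g τ hτ
        obtain ⟨q1, q2, q3⟩ := YPair_facts hc hh hH4.1 ht' hp (hFi p.1) g hτ
        refine ⟨p.1, q1, q2, ?_⟩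
        rw [q3] at hpi
        unfold QIneq
        rw [intervalIntegral.integral_neg, inner_neg_left]
        linarith
      · intro p hp
        obtain ⟨o, o1, o2⟩ := hD p hp
        refine ⟨fun r => -o r, fun τ hτ => ?_, ?_⟩
        · have := o1 τ hτ
          rw [inner_neg_left]
          linarith
        · simpa only [neg_div, neg_zero] using o2.neg
    linarith

end
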